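/- arXiv:1405.4750 — 2 statements merged into one kernel-verified Lean document; each statement's English description precedes it below -/
import Mathlib

section
/- Discrete energy dissipation: with the dG setup and scheme below, suppose W ∈ C¹(ℝ), γ > 0, μ ≥ 0, a is a symmetric bilinear form on V_q, and (u_h, v_h, τ_h) solves the semi-discrete dG scheme on [0,T). Then for all t ∈ (0,T): d/dt ( ∫₀¹ W(u_h(t,x)) + ½ v_h(t,x)² dx + (γ/2) a(u_h(t), u_h(t)) ) = − μ ‖G⁻[v_h(t)]‖²_{L²(0,1)}. -/
open scoped BigOperators
open MeasureTheory Set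

namespace DG

noncomputable def pev (q : ℕ) (c : ℕ → ℕ → ℝ) (n : ℕ) (y : ℝ) : ℝ :=
  ∑ k ∈ Finset.range (q + 1), c n k * y ^ k

noncomputable def pev' (q : ℕ) (c : ℕ → ℕ → ℝ) (n : ℕ) (y : ℝ) : ℝ :=
  ∑ k ∈ Finset.range (q + 1), (k : ℝ) * c n k * y ^ (k - 1)

noncomputable def inner2 (q N : ℕ) (x : ℕ → ℝ) (c d : ℕ → ℕ → ℝ) : ℝ :=
  ∑ n ∈ Finset.range N, ∫ y in (x n)..(x (n + 1)), pev q c n y * pev q d n y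

noncomputable def nsq (q N : ℕ) (x : ℕ → ℝ) (c : ℕ → ℕ → ℝ) : ℝ :=
  inner2 q N x c c

noncomputable def intg (q N : ℕ) (x : ℕ → ℝ) (c : ℕ → ℕ → ℝ) : ℝ :=
  ∑ n ∈ Finset.range N, ∫ y in (x n)..(x (n + 1)), pev q c n y

noncomputable def valR (q : ℕ) (x : ℕ → ℝ) (c : ℕ → ℕ → ℝ) (n : ℕ) : ℝ :=
  pev q c n (x n)

noncomputable def valL (q N : ℕ) (x : ℕ → ℝ) (c : ℕ → ℕ → ℝ) (n : ℕ) : ℝ :=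
  if n = 0 then pev q c (N - 1) (x N) else pev q c (n - 1) (x n)

noncomputable def jmp (q N : ℕ) (x : ℕ → ℝ) (c : ℕ → ℕ → ℝ) (n : ℕ) : ℝ :=
  valL q N x c n - valR q x c n

noncomputable def Bm (q N : ℕ) (x : ℕ → ℝ) (w Ψ : ℕ → ℕ → ℝ) : ℝ :=
  (∑ n ∈ Finset.range N, ∫ y in (x n)..(x (n + 1)), pev' q w n y * pev q Ψ n y)
    - ∑ n ∈ Finset.range N, jmp q N x w n * valL q N x Ψ n

noncomputable def Bp (q N : ℕ) (x : ℕ → ℝ) (w Ψ : ℕ → ℕ → ℝ) : ℝ :=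
  (∑ n ∈ Finset.range N, ∫ y in (x n)..(x (n + 1)), pev' q w n y * pev q Ψ n y)
    - ∑ n ∈ Finset.range N, jmp q N x w n * valR q x Ψ n

def IsGminus (q N : ℕ) (x : ℕ → ℝ) (w g : ℕ → ℕ → ℝ) : Prop :=
  ∀ Ψ : ℕ → ℕ → ℝ, inner2 q N x g Ψ = Bm q N x w Ψ

def IsGplus (q N : ℕ) (x : ℕ → ℝ) (w g : ℕ → ℕ → ℝ) : Prop :=
  ∀ Ψ : ℕ → ℕ → ℝ, inner2 q N x g Ψ = Bp q N x w Ψ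

noncomputable def hseg (x : ℕ → ℝ) (n : ℕ) : ℝ := x (n + 1) - x n

noncomputable def hprev (N : ℕ) (x : ℕ → ℝ) (n : ℕ) : ℝ :=
  if n = 0 then hseg x (N - 1) else hseg x (n - 1)

noncomputable def dGsq (q N : ℕ) (x : ℕ → ℝ) (w : ℕ → ℕ → ℝ) : ℝ :=
  ∑ n ∈ Finset.range N,
    ((∫ y in (x n)..(x (n + 1)), (pev' q w n y) ^ 2)
      + 2 * (jmp q N x w n) ^ 2 / (hprev N x n + hseg x n))

def Partition (N : ℕ) (x : ℕ → ℝ) : Prop :=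
  2 ≤ N ∧ x 0 = 0 ∧ x N = 1 ∧ ∀ n < N, x n < x (n + 1)

def MeshRatio (N : ℕ) (x : ℕ → ℝ) (ρ : ℝ) : Prop :=
  ∀ n < N, hseg x n ≤ ρ * hseg x ((n + 1) % N) ∧ hseg x ((n + 1) % N) ≤ ρ * hseg x n

end DG

namespace DG

/-- The nonlinear term ∫₀¹ W′(u_h) Z dx for a piecewise polynomial u_h. -/
noncomputable def intW' (q N : ℕ) (x : ℕ → ℝ) (W : ℝ → ℝ) (u Z : ℕ → ℕ → ℝ) : ℝ :=
  ∑ n ∈ Finset.range N,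
    ∫ y in (x n)..(x (n + 1)), deriv W (pev q u n y) * pev q Z n y

/-- The perturbed semi-discrete dG scheme on the time set `s` with residuals
Ru, Rv, Rτ: u, v ∈ C¹(s, V_q) (with coefficientwise derivatives u', v'),
τ ∈ C⁰(s, V_q), gv t = G⁻[v t], and for all t ∈ s and all discrete test
functions Φ, Ψ, Z:
∫ ∂ₜu Φ − G⁻[v] Φ = ∫ Ru Φ;
∫ ∂ₜv Ψ − G⁺[τ] Ψ + μ G⁻[v] G⁻[Ψ] = ∫ Rv Ψ;
∫ τ Z − W′(u) Z − γ a(u, Z) = ∫ Rτ Z.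
Here ∫₀¹ G⁻[v] Φ dx = Bm v Φ and ∫₀¹ G⁺[τ] Ψ dx = Bp τ Ψ by definition of the
discrete gradients. -/
def SolvesPert (q N : ℕ) (x : ℕ → ℝ) (s : Set ℝ) (γ μ : ℝ) (W : ℝ → ℝ)
    (a : (ℕ → ℕ → ℝ) → (ℕ → ℕ → ℝ) → ℝ)
    (u u' v v' τ gv Ru Rv Rτ : ℝ → ℕ → ℕ → ℝ) : Prop :=
  (∀ t ∈ s, ∀ n k : ℕ, HasDerivWithinAt (fun r => u r n k) (u' t n k) s t) ∧
  (∀ t ∈ s, ∀ n k : ℕ, HasDerivWithinAt (fun r => v r n k) (v' t n k) s t) ∧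
  (∀ n k : ℕ, ContinuousOn (fun t => u' t n k) s) ∧
  (∀ n k : ℕ, ContinuousOn (fun t => v' t n k) s) ∧
  (∀ n k : ℕ, ContinuousOn (fun t => τ t n k) s) ∧
  (∀ n k : ℕ, ContinuousOn (fun t => Ru t n k) s) ∧
  (∀ n k : ℕ, ContinuousOn (fun t => Rv t n k) s) ∧
  (∀ n k : ℕ, ContinuousOn (fun t => Rτ t n k) s) ∧
  (∀ t ∈ s, IsGminus q N x (v t) (gv t)) ∧
  (∀ t ∈ s, ∀ Φ : ℕ → ℕ → ℝ,
    inner2 q N x (u' t) Φ - Bm q N x (v t) Φ = inner2 q N x (Ru t) Φ) ∧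
  (∀ t ∈ s, ∀ Ψ gΨ : ℕ → ℕ → ℝ, IsGminus q N x Ψ gΨ →
    inner2 q N x (v' t) Ψ - Bp q N x (τ t) Ψ + μ * inner2 q N x (gv t) gΨ
      = inner2 q N x (Rv t) Ψ) ∧
  (∀ t ∈ s, ∀ Z : ℕ → ℕ → ℝ,
    inner2 q N x (τ t) Z - intW' q N x W (u t) Z - γ * a (u t) Z
      = inner2 q N x (Rτ t) Z)

/-- The (unperturbed) semi-discrete dG scheme: `SolvesPert` with vanishing
residuals. -/
def Solves (q N : ℕ) (x : ℕ → ℝ) (s : Set ℝ) (γ μ : ℝ) (W : ℝ → ℝ)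
    (a : (ℕ → ℕ → ℝ) → (ℕ → ℕ → ℝ) → ℝ)
    (u u' v v' τ gv : ℝ → ℕ → ℕ → ℝ) : Prop :=
  SolvesPert q N x s γ μ W a u u' v v' τ gv
    (fun _ _ _ => 0) (fun _ _ _ => 0) (fun _ _ _ => 0)

/-- The discrete energy ∫₀¹ W(u_h) + ½ v_h² dx + (γ/2) a(u_h, u_h). -/
noncomputable def energy (q N : ℕ) (x : ℕ → ℝ) (γ : ℝ) (W : ℝ → ℝ)
    (a : (ℕ → ℕ → ℝ) → (ℕ → ℕ → ℝ) → ℝ) (u v : ℕ → ℕ → ℝ) : ℝ :=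
  (∑ n ∈ Finset.range N,
    ∫ y in (x n)..(x (n + 1)), (W (pev q u n y) + (1 / 2) * (pev q v n y) ^ 2))
    + (γ / 2) * a u u

/-- Time-dependent difference of two families of discrete functions. -/
def dsub (f g : ℝ → ℕ → ℕ → ℝ) (t : ℝ) : ℕ → ℕ → ℝ :=
  fun n k => f t n k - g t n k

/-- Symmetric bilinear form on the discrete space. -/
def SymBilin (a : (ℕ → ℕ → ℝ) → (ℕ → ℕ → ℝ) → ℝ) : Prop :=
  (∀ c d : ℕ → ℕ → ℝ, a c d = a d c) ∧
  (∀ c d e : ℕ → ℕ → ℝ, a (fun n k => c n k + d n k) e = a c e + a d e) ∧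
  (∀ (s : ℝ) (c d : ℕ → ℕ → ℝ), a (fun n k => s * c n k) d = s * a c d)

end DG


namespace DG

lemma aux_mul {f g : ℝ → ℝ} {f' t : ℝ} (hf : HasDerivAt f f' t) (h0 : f t = 0)
    (hg : ContinuousAt g t) : HasDerivAt (fun r => f r * g r) (f' * g t) t := by
  rw [hasDerivAt_iff_tendsto_slope] at hf ⊢
  have h1 := hf.mul (hg.tendsto.mono_left (nhdsWithin_le_nhds (s := {t}ᶜ)))
  refine h1.congr fun r => ?_
  simp only [slope_def_field, h0]
  ring

lemma pev_cont (q n : ℕ) : Continuous (fun p : (ℕ → ℕ → ℝ) × ℝ => pev q p.1 n p.2) := by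
  unfold pev
  fun_prop

lemma pev_cont_y (q n : ℕ) (c : ℕ → ℕ → ℝ) : Continuous (fun y : ℝ => pev q c n y) := by
  unfold pev
  fun_prop

lemma pev'_cont_y (q n : ℕ) (c : ℕ → ℕ → ℝ) : Continuous (fun y : ℝ => pev' q c n y) := by
  unfold pev'
  fun_prop

lemma pev_hasDeriv (q n : ℕ) (c : ℕ → ℕ → ℝ) (y : ℝ) :
    HasDerivAt (fun y => pev q c n y) (pev' q c n y) y := by
  unfold pev pev'
  apply HasDerivAt.fun_sum
  intro k _
  exact ((hasDerivAt_pow k y).const_mul (c n k)).congr_deriv (by ring)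

/-- difference quotient -/
noncomputable def DQ (W : ℝ → ℝ) (p : ℝ × ℝ) : ℝ :=
  ∫ s in (0:ℝ)..1, deriv W (p.1 + s * (p.2 - p.1))

lemma DQ_cont {W : ℝ → ℝ} (hW : ContDiff ℝ 1 W) : Continuous (DQ W) := by
  have hd : Continuous (deriv W) := hW.continuous_deriv le_rfl
  unfold DQ
  apply intervalIntegral.continuous_parametric_intervalIntegral_of_continuous'
  fun_prop

lemma DQ_diag (W : ℝ → ℝ) (a : ℝ) : DQ W (a, a) = deriv W a := by
  simp [DQ]

lemma DQ_eq {W : ℝ → ℝ} (hW : ContDiff ℝ 1 W) (a b : ℝ) :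
    W b - W a = (b - a) * DQ W (a, b) := by
  have hd : Continuous (deriv W) := hW.continuous_deriv le_rfl
  have h := intervalIntegral.integral_eq_sub_of_hasDerivAt (a := 0) (b := 1)
    (f := fun s => W (a + s * (b - a))) (f' := fun s => (b - a) * deriv W (a + s * (b - a)))
    (fun s _ => by
      have h1 : HasDerivAt (fun s : ℝ => a + s * (b - a)) (b - a) s := by
        simpa using ((hasDerivAt_id s).mul_const (b - a)).const_add a
      have h2 := ((hW.differentiable one_ne_zero) (a + s * (b - a))).hasDerivAt
      have := HasDerivAt.comp s h2 h1
      rw [mul_comm]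
      exact this)
    ((by fun_prop : Continuous fun s => (b - a) * deriv W (a + s * (b - a))).intervalIntegrable _ _)
  rw [intervalIntegral.integral_const_mul] at h
  simp only [DQ]
  rw [h]
  simp

lemma pull (q n : ℕ) (a b : ℝ) (c : ℕ → ℕ → ℝ) (g : ℝ → ℝ) (hg : Continuous g) :
    ∫ y in a..b, g y * pev q c n y
      = ∑ k ∈ Finset.range (q + 1), c n k * ∫ y in a..b, g y * y ^ k := by
  simp_rw [← intervalIntegral.integral_const_mul]
  rw [← intervalIntegral.integral_finsetSum]
  · congr 1
    ext y
    simp only [pev, Finset.mul_sum]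
    refine Finset.sum_congr rfl fun k _ => ?_
    ring
  · intro k _
    exact (by fun_prop : Continuous fun y => c n k * (g y * y ^ k)).intervalIntegrable _ _

lemma curve_cont {c : ℝ → ℕ → ℕ → ℝ} {t : ℝ}
    (h : ∀ n k, ContinuousAt (fun r => c r n k) t) : ContinuousAt c t := by
  rw [continuousAt_pi]
  intro n
  rw [continuousAt_pi]
  intro k
  exact h n k

lemma deriv_W (q n : ℕ) (a b : ℝ) {W : ℝ → ℝ} (hW : ContDiff ℝ 1 W)
    (c : ℝ → ℕ → ℕ → ℝ) (c' : ℕ → ℕ → ℝ) (t : ℝ)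
    (hc : ∀ n k, HasDerivAt (fun r => c r n k) (c' n k) t) :
    HasDerivAt (fun r => ∫ y in a..b, W (pev q (c r) n y))
      (∫ y in a..b, deriv W (pev q (c t) n y) * pev q c' n y) t := by
  have hd : Continuous (deriv W) := hW.continuous_deriv le_rfl
  have hD := DQ_cont hW
  have hp := pev_cont q n
  have hcont : ContinuousAt c t := curve_cont fun n k => (hc n k).continuousAt
  have hy := fun c => pev_cont_y q n c
  have e : (fun r => ∫ y in a..b, W (pev q (c r) n y)) = fun r =>
      (∫ y in a..b, W (pev q (c t) n y)) +
      ∑ k ∈ Finset.range (q + 1), (c r n k - c t n k) *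
        ∫ y in a..b, DQ W (pev q (c t) n y, pev q (c r) n y) * y ^ k := by
    ext r
    have h1 := pull q n a b (fun n k => c r n k - c t n k)
      (fun y => DQ W (pev q (c t) n y, pev q (c r) n y))
      (hD.comp ((hy _).prodMk (hy _)))
    rw [← h1, ← intervalIntegral.integral_add]
    · congr 1
      ext y
      have h2 := DQ_eq hW (pev q (c t) n y) (pev q (c r) n y)
      have h3 : pev q (fun n k => c r n k - c t n k) n y = pev q (c r) n y - pev q (c t) n y := by
        simp only [pev, sub_mul, Finset.sum_sub_distrib]
      rw [h3]
      linarith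
    · exact (hW.continuous.comp (hy _)).intervalIntegrable _ _
    · exact ((hD.comp ((hy _).prodMk (hy _))).mul (hy _)).intervalIntegrable _ _
  rw [e, pull q n a b c' (fun y => deriv W (pev q (c t) n y)) (hd.comp (hy _))]
  apply HasDerivAt.const_add
  apply HasDerivAt.fun_sum
  intro k _
  have hg : Continuous fun d : ℕ → ℕ → ℝ =>
      ∫ y in a..b, DQ W (pev q (c t) n y, pev q d n y) * y ^ k := by
    apply intervalIntegral.continuous_parametric_intervalIntegral_of_continuous'
    have : Continuous fun p : (ℕ → ℕ → ℝ) × ℝ => pev q (c t) n p.2 := (hy _).comp continuous_snd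
    exact (hD.comp (this.prodMk hp)).mul (by fun_prop)
  have := aux_mul ((hc n k).sub_const (c t n k)) (sub_self _)
    (ContinuousAt.comp (f := c) (x := t) hg.continuousAt hcont)
  simpa [Function.comp_def, DQ_diag] using this

lemma sum_shift (N : ℕ) (hN : 1 ≤ N) (q : ℕ) (x : ℕ → ℝ) (v w : ℕ → ℕ → ℝ) :
    ∑ n ∈ Finset.range N, pev q v n (x (n+1)) * pev q w n (x (n+1))
      = ∑ n ∈ Finset.range N, valL q N x v n * valL q N x w n := by
  obtain ⟨M, rfl⟩ : ∃ M, N = M + 1 := ⟨N - 1, by omega⟩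
  rw [Finset.sum_range_succ, Finset.sum_range_succ']
  simp [valL]

lemma ibp (N : ℕ) (hN : 1 ≤ N) (q : ℕ) (x : ℕ → ℝ) (v w : ℕ → ℕ → ℝ) :
    Bm q N x v w = - Bp q N x w v := by
  have h1 : ∀ n, (∫ y in (x n)..(x (n + 1)), pev' q v n y * pev q w n y)
      + (∫ y in (x n)..(x (n + 1)), pev' q w n y * pev q v n y)
      = pev q v n (x (n+1)) * pev q w n (x (n+1)) - valR q x v n * valR q x w n := by
    intro n
    have hi : ∀ c d : ℕ → ℕ → ℝ, IntervalIntegrable (fun y => pev' q c n y * pev q d n y)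
        volume (x n) (x (n+1)) := fun c d =>
      ((pev'_cont_y q n c).mul (pev_cont_y q n d)).intervalIntegrable _ _
    rw [← intervalIntegral.integral_add (hi _ _) (hi _ _)]
    rw [intervalIntegral.integral_eq_sub_of_hasDerivAt
      (f := fun y => pev q v n y * pev q w n y) _ ((hi _ _).add (hi _ _))]
    · rfl
    · intro y _
      exact ((pev_hasDeriv q n v y).mul (pev_hasDeriv q n w y)).congr_deriv (by ring)
  have h2 := Finset.sum_congr rfl (fun n (_ : n ∈ Finset.range N) => h1 n)
  rw [Finset.sum_add_distrib, Finset.sum_sub_distrib, sum_shift N hN] at h2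
  have h3 : ∑ n ∈ Finset.range N, jmp q N x v n * valL q N x w n
      + ∑ n ∈ Finset.range N, jmp q N x w n * valR q x v n
      = ∑ n ∈ Finset.range N, valL q N x v n * valL q N x w n
       - ∑ n ∈ Finset.range N, valR q x v n * valR q x w n := by
    rw [← Finset.sum_add_distrib, ← Finset.sum_sub_distrib]
    refine Finset.sum_congr rfl fun n _ => ?_
    simp only [jmp]
    ring
  unfold Bm Bp
  linarith

end DG

/-- Discrete energy dissipation, Remark "Discrete entropy
inequality": if (u_h, v_h, τ_h) solves the semi-discrete dG scheme on [0,T)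
then for t ∈ (0,T),
d/dt ( ∫₀¹ W(u_h) + ½ v_h² dx + (γ/2) a(u_h, u_h) ) = − μ ‖G⁻[v_h(t)]‖²_{L²(0,1)}. -/
theorem stmt_13 (q N : ℕ) (hq : 1 ≤ q) (x : ℕ → ℝ) (hpart : DG.Partition N x)
    (T γ μ : ℝ) (hT : 0 < T) (hγ : 0 < γ) (hμ : 0 ≤ μ)
    (W : ℝ → ℝ) (hW : ContDiff ℝ 1 W)
    (a : (ℕ → ℕ → ℝ) → (ℕ → ℕ → ℝ) → ℝ) (ha : DG.SymBilin a)
    (u u' v v' τ gv : ℝ → ℕ → ℕ → ℝ)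
    (hsol : DG.Solves q N x (Set.Ico 0 T) γ μ W a u u' v v' τ gv) :
    ∀ t ∈ Set.Ioo (0 : ℝ) T,
      HasDerivAt (fun r => DG.energy q N x γ W a (u r) (v r))
        (-(μ * DG.nsq q N x (gv t))) t := by
  intro t ht
  obtain ⟨hu, hv, -, -, hτ, -, -, -, hG, e1, e2, e3⟩ := hsol
  obtain ⟨hsym, hadd, hsmul⟩ := ha
  have hd : Continuous (deriv W) := hW.continuous_deriv le_rfl
  have htI : t ∈ Set.Ico 0 T := ⟨ht.1.le, ht.2⟩
  have hnh : Set.Ico 0 T ∈ nhds t := Ico_mem_nhds ht.1 ht.2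
  have hu' : ∀ n k, HasDerivAt (fun r => u r n k) (u' t n k) t :=
    fun n k => (hu t htI n k).hasDerivAt hnh
  have hv' : ∀ n k, HasDerivAt (fun r => v r n k) (v' t n k) t :=
    fun n k => (hv t htI n k).hasDerivAt hnh
  have hτc : ContinuousAt τ t := DG.curve_cont fun n k => (hτ n k).continuousAt hnh
  have huc : ContinuousAt u t := DG.curve_cont fun n k => (hu' n k).continuousAt
  have hz : ∀ Z, DG.inner2 q N x (fun _ _ => 0) Z = 0 := by
    intro Z; simp [DG.inner2, DG.pev]
  simp only [hz] at e1 e2 e3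
  -- the form on solutions
  set G : (ℕ → ℕ → ℝ) → (ℕ → ℕ → ℝ) → ℕ → ℕ → ℝ := fun p c n k =>
    (∫ y in (x n)..(x (n + 1)), DG.pev q p n y * y ^ k)
     - ∫ y in (x n)..(x (n + 1)), deriv W (DG.pev q c n y) * y ^ k with hGdef
  have hform : ∀ r ∈ Set.Ico 0 T, ∀ Z, γ * a (u r) Z
      = ∑ n ∈ Finset.range N, ∑ k ∈ Finset.range (q + 1), Z n k * G (τ r) (u r) n k := by
    intro r hr Z
    have h := e3 r hr Z
    have h1 : DG.inner2 q N x (τ r) Z - DG.intW' q N x W (u r) Z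
        = ∑ n ∈ Finset.range N, ∑ k ∈ Finset.range (q + 1), Z n k * G (τ r) (u r) n k := by
      unfold DG.inner2 DG.intW'
      rw [← Finset.sum_sub_distrib]
      refine Finset.sum_congr rfl fun n _ => ?_
      rw [DG.pull q n _ _ Z _ (DG.pev_cont_y q n _),
        DG.pull q n _ _ Z (fun y => deriv W (DG.pev q (u r) n y)) (hd.comp (DG.pev_cont_y q n _)), ← Finset.sum_sub_distrib]
      refine Finset.sum_congr rfl fun k _ => ?_
      simp only [hGdef]
      ring
    linarith
  have hGc : ∀ n k, ContinuousAt (fun r => G (τ r) (u r) n k) t := by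
    intro n k
    have hp := DG.pev_cont q n
    have c1 : Continuous fun p : ℕ → ℕ → ℝ =>
        ∫ y in (x n)..(x (n + 1)), DG.pev q p n y * y ^ k := by
      apply intervalIntegral.continuous_parametric_intervalIntegral_of_continuous'
      exact hp.mul (by fun_prop)
    have c2 : Continuous fun p : ℕ → ℕ → ℝ =>
        ∫ y in (x n)..(x (n + 1)), deriv W (DG.pev q p n y) * y ^ k := by
      apply intervalIntegral.continuous_parametric_intervalIntegral_of_continuous'
      exact (hd.comp hp).mul (by fun_prop)
    exact (ContinuousAt.comp (f := τ) (x := t) c1.continuousAt hτc).sub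
      (ContinuousAt.comp (f := u) (x := t) c2.continuousAt huc)
  have hA : HasDerivAt (fun r => (γ / 2) * a (u r) (u r)) (γ * a (u t) (u' t)) t := by
    have key : HasDerivAt (fun r => (γ / 2) * a (u t) (u t) +
        ∑ n ∈ Finset.range N, ∑ k ∈ Finset.range (q + 1),
          (u r n k - u t n k) * ((G (τ r) (u r) n k + G (τ t) (u t) n k) / 2))
        (∑ n ∈ Finset.range N, ∑ k ∈ Finset.range (q + 1),
          u' t n k * ((G (τ t) (u t) n k + G (τ t) (u t) n k) / 2)) t := by
      apply HasDerivAt.const_add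
      apply HasDerivAt.fun_sum
      intro n _
      apply HasDerivAt.fun_sum
      intro k _
      exact DG.aux_mul (g := fun r => (G (τ r) (u r) n k + G (τ t) (u t) n k) / 2)
        ((hu' n k).sub_const _) (sub_self _) (((hGc n k).add continuousAt_const).div_const 2)
    have e4 : γ * a (u t) (u' t) = ∑ n ∈ Finset.range N, ∑ k ∈ Finset.range (q + 1),
          u' t n k * ((G (τ t) (u t) n k + G (τ t) (u t) n k) / 2) := by
      rw [hform t htI]
      simp
    rw [e4]
    refine key.congr_of_eventuallyEq ?_
    filter_upwards [hnh] with r hr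
    have s1 := hform r hr (u r)
    have s2 := hform r hr (u t)
    have s3 := hform t htI (u r)
    have s4 := hform t htI (u t)
    have s5 : ∑ n ∈ Finset.range N, ∑ k ∈ Finset.range (q + 1),
          (u r n k - u t n k) * ((G (τ r) (u r) n k + G (τ t) (u t) n k) / 2)
        = (γ * a (u r) (u r) - γ * a (u r) (u t) + γ * a (u t) (u r) - γ * a (u t) (u t)) / 2 := by
      rw [s1, s2, s3, s4]
      simp only [← Finset.sum_sub_distrib, ← Finset.sum_add_distrib, Finset.sum_div]
      refine Finset.sum_congr rfl fun n _ => Finset.sum_congr rfl fun k _ => ?_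
      ring
    rw [s5, hsym (u r) (u t)]
    ring
  have hW2 : ContDiff ℝ 1 (fun z : ℝ => (1 / 2) * z ^ 2) := by fun_prop
  have hdW2 : deriv (fun z : ℝ => (1 / 2) * z ^ 2) = fun z => z := by
    ext z
    simp
  have hB : HasDerivAt (fun r => ∑ n ∈ Finset.range N,
      ∫ y in (x n)..(x (n + 1)), (W (DG.pev q (u r) n y) + (1 / 2) * (DG.pev q (v r) n y) ^ 2))
      (DG.intW' q N x W (u t) (u' t) + DG.inner2 q N x (v t) (v' t)) t := by
    unfold DG.intW' DG.inner2
    rw [← Finset.sum_add_distrib]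
    apply HasDerivAt.fun_sum
    intro n _
    have h1 := DG.deriv_W q n (x n) (x (n+1)) hW u (u' t) t hu'
    have h2 := DG.deriv_W q n (x n) (x (n+1)) hW2 v (v' t) t hv'
    rw [hdW2] at h2
    refine (h1.add h2).congr_of_eventuallyEq (Filter.Eventually.of_forall fun r => ?_)
    exact intervalIntegral.integral_add
      ((hW.continuous.comp (DG.pev_cont_y q n _)).intervalIntegrable _ _)
      ((hW2.continuous.comp (DG.pev_cont_y q n _)).intervalIntegrable _ _)
  have hcomm : ∀ c d, DG.inner2 q N x c d = DG.inner2 q N x d c := by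
    intro c d
    simp only [DG.inner2, mul_comm]
  have hfin := hB.add hA
  have f1 := e1 t htI (τ t)
  have f2 := e2 t htI (v t) (gv t) (hG t htI)
  have f3 := e3 t htI (u' t)
  have f4 := DG.ibp N (by have := hpart.1; omega) q x (v t) (τ t)
  have f5 := hcomm (u' t) (τ t)
  have f6 := hcomm (v t) (v' t)
  have f7 : -(μ * DG.nsq q N x (gv t)) = DG.intW' q N x W (u t) (u' t)
      + DG.inner2 q N x (v t) (v' t) + γ * a (u t) (u' t) := by
    unfold DG.nsq
    linarith
  rw [f7]
  exact hfin
end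

section
/- Estimate of the reduced relative entropy (Gronwall bound): with the dG setup, scheme, perturbed scheme and reduced relative entropy η_R defined below, assume W ∈ C³(ℝ) with W ≥ 0, γ > 0, μ ≥ 0, T > 0; assume the mesh-ratio bound with constant ρ; assume the symmetric bilinear form a on V_q satisfies |w|_dG² ≤ c a(w,w) for all w ∈ V_q and some c > 0. Let (u_h, v_h, τ_h) solve the semi-discrete dG scheme, let (ũ_h, ṽ_h, τ̃_h) be a perturbed solution with residuals R_u ≡ 0 and R_v, R_τ ∈ C⁰([0,T), V_q), assume ∫₀¹ (u_h(0) − ũ_h(0)) dx = 0, and assume ‖ũ_h(t)‖_{W^{1,∞}} ≤ M (cellwise) for all t ∈ [0,T). Then there exists a constant C > 0, depending only on q, ρ, c, γ, T, W, M and an upper bound E₀ on the initial discrete energy ∫₀¹ W(u_h(0)) + ½ v_h(0)² dx + (γ/2) a(u_h(0), u_h(0)), but not otherwise on the partition, such that for all 0 ≤ t < T: d/dt η_R(t) ≤ C η_R(t) + C ∫₀¹ ( R_v(t)² + 𝔥⁻² R_τ(t)² ) dx, and consequently η_R(t) ≤ ( η_R(0) + C ∫₀ᵗ ∫₀¹ R_v²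 dx ds + C ∫₀ᵗ ∫₀¹ 𝔥⁻² R_τ² dx ds ) e^{Ct}, where 𝔥(x) := h_n for x ∈ (x_n, x_{n+1}). -/
open scoped BigOperators
open MeasureTheory Set

namespace DG

/-- The discrete reduced relative entropy
η_R(t) = ½‖v_h−ṽ_h‖² + (γ/2) a(u_h−ũ_h, u_h−ũ_h)
          + (μ/4)∫₀ᵗ ‖G⁻[v_h−ṽ_h]‖² ds
(using G⁻[v_h−ṽ_h] = G⁻[v_h] − G⁻[ṽ_h]). -/
noncomputable def etaR (q N : ℕ) (x : ℕ → ℝ) (γ μ : ℝ)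
    (a : (ℕ → ℕ → ℝ) → (ℕ → ℕ → ℝ) → ℝ)
    (u v gv ut vt gvt : ℝ → ℕ → ℕ → ℝ) (t : ℝ) : ℝ :=
  (1 / 2) * nsq q N x (dsub v vt t)
    + (γ / 2) * a (dsub u ut t) (dsub u ut t)
    + (μ / 4) * ∫ s in (0 : ℝ)..t, nsq q N x (dsub gv gvt s)

/-- The weighted residual term ∫₀¹ 𝔥⁻² R_τ² dx = ∑_n h_n⁻² ∫_{I_n} R_τ². -/
noncomputable def wRτ (q N : ℕ) (x : ℕ → ℝ) (Rτ : ℕ → ℕ → ℝ) : ℝ :=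
  ∑ n ∈ Finset.range N,
    (∫ y in (x n)..(x (n + 1)), (pev q Rτ n y) ^ 2) / (hseg x n) ^ 2

end DG

namespace DGaux
open DG

lemma pev_cont (q : ℕ) (c : ℕ → ℕ → ℝ) (n : ℕ) : Continuous (pev q c n) := by
  unfold pev; fun_prop

lemma pev'_cont (q : ℕ) (c : ℕ → ℕ → ℝ) (n : ℕ) : Continuous (pev' q c n) := by
  unfold pev'; fun_prop

lemma pev_deriv (q : ℕ) (c : ℕ → ℕ → ℝ) (n : ℕ) (y : ℝ) :
    HasDerivAt (pev q c n) (pev' q c n y) y := by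
  unfold pev pev'
  apply HasDerivAt.fun_sum
  intro k _
  have := (hasDerivAt_pow k y).const_mul (c n k)
  rw [show (k:ℝ) * c n k * y ^ (k-1) = c n k * ((k:ℝ) * y ^ (k-1)) by ring]
  exact this

lemma ref_est (q : ℕ) : ∃ m > (0:ℝ), ∀ d : Fin (q+1) → ℝ,
    m * ‖d‖ ^ 2 ≤ ∫ s in (0:ℝ)..1, (∑ k, d k * s ^ (k:ℕ)) ^ 2 := by
  set F : (Fin (q+1) → ℝ) → ℝ := fun d => ∫ s in (0:ℝ)..1, (∑ k, d k * s ^ (k:ℕ)) ^ 2 with hF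
  have hcont : Continuous F := by
    apply intervalIntegral.continuous_parametric_intervalIntegral_of_continuous'
    fun_prop
  have hpos : ∀ d, d ≠ 0 → 0 < F d := by
    intro d hd
    have h0 : 0 ≤ F d := intervalIntegral.integral_nonneg (by norm_num) (fun s _ => sq_nonneg _)
    rcases h0.lt_or_eq with h | h
    · exact h
    exfalso
    apply hd
    have hz : ∀ s ∈ Icc (0:ℝ) 1, (∑ k, d k * s ^ (k:ℕ)) = 0 := by
      by_contra hne
      push Not at hne
      obtain ⟨s, hs, hs'⟩ := hne
      have : 0 < F d := by
        apply intervalIntegral.integral_pos (by norm_num)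
        · fun_prop
        · intro y _; positivity
        · exact ⟨s, hs, by positivity⟩
      linarith
    let P : Polynomial ℝ := ∑ k : Fin (q+1), Polynomial.C (d k) * Polynomial.X ^ (k:ℕ)
    have hP : P = 0 := by
      apply Polynomial.eq_zero_of_infinite_isRoot
      apply Set.Infinite.mono (s := Icc (0:ℝ) 1)
      · intro s hs
        simp only [Set.mem_ofPred_eq, Polynomial.IsRoot.def, P, Polynomial.eval_finsetSum]
        simpa using hz s hs
      · exact Set.Icc_infinite (by norm_num)
    ext k
    have := congrArg (fun p => Polynomial.coeff p (k:ℕ)) hP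
    simp only [P, Polynomial.finsetSum_coeff, Polynomial.coeff_C_mul, Polynomial.coeff_X_pow,
      Polynomial.coeff_zero] at this
    simpa [Fin.val_inj] using this
  have hne : (Metric.sphere (0 : Fin (q+1) → ℝ) 1).Nonempty := by
    refine ⟨fun _ => 1, ?_⟩
    simp
  obtain ⟨d0, hd0, hmin⟩ := (isCompact_sphere (0 : Fin (q+1) → ℝ) 1).exists_isMinOn hne
    hcont.continuousOn
  refine ⟨F d0, hpos d0 ?_, ?_⟩
  · rintro rfl; simp at hd0
  intro d
  by_cases hd : d = 0
  · subst hd; simp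
  have hn : 0 < ‖d‖ := norm_pos_iff.mpr hd
  have h1 : F d0 ≤ F (‖d‖⁻¹ • d) := hmin (by simp [norm_smul, hn.ne'])
  have h2 : F (‖d‖⁻¹ • d) = (‖d‖⁻¹)^2 * F d := by
    simp only [hF]
    rw [← intervalIntegral.integral_const_mul]
    congr 1; ext s
    rw [← mul_pow, Finset.mul_sum]
    simp [mul_assoc]
  rw [h2] at h1
  calc F d0 * ‖d‖^2 ≤ (‖d‖⁻¹)^2 * F d * ‖d‖^2 := by gcongr
    _ = F d := by field_simp

lemma pev_scale (q : ℕ) (c : ℕ → ℕ → ℝ) (n : ℕ) (a h : ℝ) :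
    ∃ d : Fin (q+1) → ℝ, ∀ s, pev q c n (a + h * s) = ∑ k, d k * s ^ (k:ℕ) := by
  let P : Polynomial ℝ := ∑ k ∈ Finset.range (q+1), Polynomial.C (c n k) * Polynomial.X ^ k
  let Q : Polynomial ℝ := P.comp (Polynomial.C a + Polynomial.C h * Polynomial.X)
  have hP : P.natDegree ≤ q := by
    apply Polynomial.natDegree_sum_le_of_forall_le
    intro k hk
    refine (Polynomial.natDegree_C_mul_X_pow_le _ _).trans ?_
    have := Finset.mem_range.mp hk; omega
  have hl : (Polynomial.C a + Polynomial.C h * Polynomial.X : Polynomial ℝ).natDegree ≤ 1 := by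
    rw [add_comm]
    exact Polynomial.natDegree_linear_le
  have hQ : Q.natDegree < q + 1 := by
    have h1 := Polynomial.natDegree_comp_le (p := P)
      (q := (Polynomial.C a + Polynomial.C h * Polynomial.X : Polynomial ℝ))
    have h2 := Nat.mul_le_mul hP hl
    have : Q.natDegree ≤ q := by simpa using h1.trans h2
    omega
  refine ⟨fun k => Q.coeff k, fun s => ?_⟩
  have h3 : pev q c n (a + h*s) = Q.eval s := by
    simp only [Q, P, Polynomial.eval_comp, Polynomial.eval_finsetSum, pev]
    simp
  rw [h3, Polynomial.eval_eq_sum_range' hQ, Finset.sum_range]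

lemma inv_est (q : ℕ) : ∃ K > (0:ℝ), ∀ (c : ℕ → ℕ → ℝ) (n : ℕ) (a b : ℝ), a < b →
    (∀ y ∈ Icc a b, (b - a) * pev q c n y ^ 2 ≤ K * ∫ y in a..b, pev q c n y ^ 2) ∧
    ((b - a)^2 * ∫ y in a..b, pev' q c n y ^ 2) ≤ K * ∫ y in a..b, pev q c n y ^ 2 := by
  obtain ⟨m, hm, hest⟩ := ref_est q
  set B : ℝ := ((q+1) * (q+1))^2 with hB
  have hq1 : (1:ℝ) ≤ (q:ℝ)+1 := by have : (0:ℝ) ≤ q := Nat.cast_nonneg q; linarith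
  refine ⟨B / m, by positivity, ?_⟩
  intro c n a b hab
  obtain ⟨d, hd⟩ := pev_scale q c n a (b-a)
  have hh : 0 < b - a := by linarith
  have hI : ∫ y in a..b, pev q c n y ^ 2 = (b-a) * ∫ s in (0:ℝ)..1, (∑ k, d k * s ^ (k:ℕ)) ^ 2 := by
    have := intervalIntegral.mul_integral_comp_add_mul (f := fun y => pev q c n y ^ 2) (b-a) a
      (a := 0) (b := 1)
    simp only [mul_zero, add_zero, mul_one, add_sub_cancel] at this
    rw [← this]
    simp only [hd]
  have hI2 : (b-a) * (m * ‖d‖^2) ≤ ∫ y in a..b, pev q c n y ^ 2 := by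
    rw [hI]; exact mul_le_mul_of_nonneg_left (hest d) hh.le
  have hdk : ∀ k, |d k| ≤ ‖d‖ := fun k => norm_le_pi_norm d k
  have hsy : ∀ y ∈ Icc a b, ∃ s ∈ Icc (0:ℝ) 1, y = a + (b-a)*s := by
    intro y hy
    refine ⟨(y-a)/(b-a), ⟨div_nonneg (by linarith [hy.1]) hh.le, ?_⟩, by field_simp; ring⟩
    rw [div_le_one hh]; linarith [hy.2]
  constructor
  · intro y hy
    obtain ⟨s, hs, rfl⟩ := hsy y hy
    rw [hd]
    have h1 : |∑ k, d k * s ^ (k:ℕ)| ≤ (q+1) * (q+1) * ‖d‖ := by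
      calc |∑ k, d k * s ^ (k:ℕ)| ≤ ∑ k, |d k * s ^ (k:ℕ)| := Finset.abs_sum_le_sum_abs _ _
        _ ≤ ∑ k : Fin (q+1), ‖d‖ := by
          apply Finset.sum_le_sum; intro k _
          rw [abs_mul, abs_of_nonneg (pow_nonneg hs.1 _)]
          calc |d k| * s^(k:ℕ) ≤ ‖d‖ * 1 :=
                mul_le_mul (hdk k) (pow_le_one₀ hs.1 hs.2) (pow_nonneg hs.1 _) (norm_nonneg _)
            _ = _ := mul_one _
        _ = (q+1) * 1 * ‖d‖ := by simp
        _ ≤ _ := by gcongr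
    have h2 : (∑ k, d k * s ^ (k:ℕ))^2 ≤ B * ‖d‖^2 := by
      rw [← sq_abs, hB, ← mul_pow]; gcongr
    calc (b-a) * (∑ k, d k * s ^ (k:ℕ))^2 ≤ (b-a) * (B * ‖d‖^2) := by gcongr
      _ = B/m * ((b-a) * (m * ‖d‖^2)) := by field_simp
      _ ≤ _ := by gcongr
  · have hpt : ∀ y ∈ Icc a b, (b-a)^2 * pev' q c n y ^ 2 ≤ B * ‖d‖^2 := by
      intro y hy
      obtain ⟨s, hs, rfl⟩ := hsy y hy
      have h1 : HasDerivAt (fun s => pev q c n (a + (b-a)*s))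
          (pev' q c n (a + (b-a)*s) * (b-a)) s := by
        have := (((hasDerivAt_id s).const_mul (b-a)).const_add a)
        simp only [id, mul_one] at this
        exact (pev_deriv q c n (a + (b-a)*s)).comp s this
      have h2 : HasDerivAt (fun s => ∑ k, d k * s ^ (k:ℕ))
          (∑ k : Fin (q+1), d k * ((k:ℕ) * s ^ ((k:ℕ)-1))) s := by
        apply HasDerivAt.fun_sum; intro k _
        exact (hasDerivAt_pow (k:ℕ) s).const_mul (d k)
      have h3 := h1.unique (by simpa only [hd] using h2)
      rw [← mul_pow, mul_comm (b-a), h3, hB, ← sq_abs, ← mul_pow]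
      have h4 : |∑ k : Fin (q+1), d k * ((k:ℕ) * s ^ ((k:ℕ)-1))| ≤ (q+1) * (q+1) * ‖d‖ := by
        calc _ ≤ ∑ k : Fin (q+1), |d k * ((k:ℕ) * s ^ ((k:ℕ)-1))| :=
              Finset.abs_sum_le_sum_abs _ _
          _ ≤ ∑ k : Fin (q+1), ‖d‖ * ((q+1) * 1) := by
            apply Finset.sum_le_sum; intro k _
            rw [abs_mul, abs_mul, abs_of_nonneg (pow_nonneg hs.1 _), Nat.abs_cast]
            have hk : ((k:ℕ):ℝ) ≤ q + 1 := by exact_mod_cast k.2.le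
            have := pow_le_one₀ hs.1 hs.2 (n := (k:ℕ)-1)
            have := pow_nonneg hs.1 ((k:ℕ)-1)
            gcongr
            exact hdk k
          _ = (q+1) * (q+1) * ‖d‖ := by simp; ring
      gcongr
    have hint : ∫ y in a..b, (b-a)^2 * pev' q c n y ^ 2 ≤ ∫ y in a..b, B * ‖d‖^2 := by
      apply intervalIntegral.integral_mono_on hab.le
      · exact Continuous.intervalIntegrable (by have := pev'_cont q c n; fun_prop) _ _
      · exact Continuous.intervalIntegrable (by fun_prop) _ _
      · exact hpt
    rw [intervalIntegral.integral_const_mul, intervalIntegral.integral_const, smul_eq_mul] at hint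
    calc _ ≤ _ := hint
      _ = B/m * ((b-a) * (m * ‖d‖^2)) := by field_simp
      _ ≤ _ := by gcongr

end DGaux

namespace DGaux
open DG

def prv (N n : ℕ) : ℕ := if n = 0 then N - 1 else n - 1

lemma sum_prv {N : ℕ} (hN : 1 ≤ N) (f : ℕ → ℝ) :
    ∑ n ∈ Finset.range N, f (prv N n) = ∑ n ∈ Finset.range N, f n := by
  obtain ⟨m, rfl⟩ : ∃ m, N = m + 1 := ⟨N - 1, by omega⟩
  rw [Finset.sum_range_succ', Finset.sum_range_succ]
  simp [prv]

lemma prv_lt {N n : ℕ} (hn : n < N) : prv N n < N := by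
  unfold prv; split_ifs <;> omega

lemma valL_eq {q N : ℕ} (hN : 1 ≤ N) (x : ℕ → ℝ) (c : ℕ → ℕ → ℝ) (n : ℕ) :
    valL q N x c n = pev q c (prv N n) (x (prv N n + 1)) := by
  unfold valL prv
  split_ifs with h
  · rw [Nat.sub_add_cancel hN]
  · rw [Nat.sub_add_cancel (by omega : 1 ≤ n)]

lemma hprev_eq (N : ℕ) (x : ℕ → ℝ) (n : ℕ) : hprev N x n = hseg x (prv N n) := by
  unfold hprev prv; split_ifs <;> rfl

lemma hseg_pos {N : ℕ} {x : ℕ → ℝ} (hp : Partition N x) {n : ℕ} (hn : n < N) : 0 < hseg x n := by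
  unfold hseg; linarith [hp.2.2.2 n hn]

lemma sum_hseg {N : ℕ} {x : ℕ → ℝ} (hp : Partition N x) :
    ∑ n ∈ Finset.range N, hseg x n = 1 := by
  unfold hseg; rw [Finset.sum_range_sub, hp.2.1, hp.2.2.1]; norm_num

lemma mesh_prv {N : ℕ} {x : ℕ → ℝ} {ρ : ℝ} (hm : MeshRatio N x ρ) {n : ℕ} (hn : n < N) :
    hseg x (prv N n) ≤ ρ * hseg x n := by
  have h := (hm (prv N n) (prv_lt hn)).1
  have h2 : (prv N n + 1) % N = n := by
    unfold prv; split_ifs with h0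
    · rw [Nat.sub_add_cancel (by omega), Nat.mod_self, h0]
    · rw [Nat.sub_add_cancel (by omega), Nat.mod_eq_of_lt hn]
  rwa [h2] at h

lemma nsq_eq (q N : ℕ) (x : ℕ → ℝ) (c : ℕ → ℕ → ℝ) :
    nsq q N x c = ∑ n ∈ Finset.range N, ∫ y in (x n)..(x (n+1)), pev q c n y ^ 2 := by
  unfold nsq inner2; simp only [sq]

lemma cell_nonneg {N : ℕ} {x : ℕ → ℝ} (hp : Partition N x) {n : ℕ} (hn : n < N) (f : ℝ → ℝ) :
    0 ≤ ∫ y in (x n)..(x (n+1)), f y ^ 2 :=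
  intervalIntegral.integral_nonneg (hp.2.2.2 n hn).le (fun _ _ => sq_nonneg _)

lemma nsq_nonneg {q N : ℕ} {x : ℕ → ℝ} (hp : Partition N x) (c : ℕ → ℕ → ℝ) :
    0 ≤ nsq q N x c := by
  rw [nsq_eq]
  exact Finset.sum_nonneg fun n hn => cell_nonneg hp (Finset.mem_range.mp hn) _

lemma wR_nonneg {q N : ℕ} {x : ℕ → ℝ} (hp : Partition N x) (c : ℕ → ℕ → ℝ) :
    0 ≤ wRτ q N x c := by
  unfold wRτ
  exact Finset.sum_nonneg fun n hn =>
    div_nonneg (cell_nonneg hp (Finset.mem_range.mp hn) _) (sq_nonneg _)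

lemma dGsq_nonneg {q N : ℕ} {x : ℕ → ℝ} (hp : Partition N x) (c : ℕ → ℕ → ℝ) :
    0 ≤ dGsq q N x c := by
  unfold dGsq
  refine Finset.sum_nonneg fun n hn => ?_
  have hn := Finset.mem_range.mp hn
  have h1 := hseg_pos hp hn
  have h2 := hseg_pos hp (prv_lt hn)
  rw [hprev_eq]
  have := cell_nonneg hp hn (pev' q c n)
  positivity

lemma cs_int {a b : ℝ} (hab : a ≤ b) {f : ℝ → ℝ} (hf : Continuous f) :
    (∫ y in a..b, f y) ^ 2 ≤ (b - a) * ∫ y in a..b, f y ^ 2 := by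
  rcases hab.eq_or_lt with rfl | hlt
  · simp
  set I := ∫ y in a..b, f y with hI
  have hh : 0 < b - a := by linarith
  have h0 : 0 ≤ ∫ y in a..b, ((b-a) * f y - I) ^ 2 :=
    intervalIntegral.integral_nonneg hab (fun _ _ => sq_nonneg _)
  have h1 : ∫ y in a..b, ((b-a) * f y - I) ^ 2
      = (b-a)^2 * (∫ y in a..b, f y ^2) - (2 * (b-a) * I) * I + I^2 * (b-a) := by
    have : ∀ y, ((b-a) * f y - I) ^ 2 = (b-a)^2 * f y ^2 - (2 * (b-a) * I) * f y + I^2 := by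
      intro y; ring
    simp only [this]
    rw [intervalIntegral.integral_add, intervalIntegral.integral_sub,
      intervalIntegral.integral_const_mul, intervalIntegral.integral_const_mul,
      intervalIntegral.integral_const, smul_eq_mul, ← hI]
    · ring
    all_goals exact Continuous.intervalIntegrable (by fun_prop) _ _
  rw [h1] at h0
  have h2 : 0 ≤ (b-a) * ((b - a) * (∫ y in a..b, f y ^ 2) - I^2) := by nlinarith
  have := nonneg_of_mul_nonneg_right h2 hh
  linarith

lemma ftc_sq {a b : ℝ} {f f' : ℝ → ℝ} (hf' : Continuous f')
    (hf : ∀ y, HasDerivAt f (f' y) y) {y z : ℝ} (hy : y ∈ Icc a b) (hz : z ∈ Icc a b) :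
    (f y - f z) ^ 2 ≤ (b - a) * ∫ y in a..b, f' y ^ 2 := by
  wlog hyz : z ≤ y generalizing y z
  · have := this hz hy (not_le.mp hyz).le
    nlinarith
  have h1 : f y - f z = ∫ s in z..y, f' s :=
    (intervalIntegral.integral_eq_sub_of_hasDerivAt (fun s _ => hf s)
      (hf'.intervalIntegrable _ _)).symm
  rw [h1]
  refine (cs_int hyz hf').trans ?_
  have h2 : ∫ s in z..y, f' s ^ 2 ≤ ∫ s in a..b, f' s ^ 2 := by
    apply intervalIntegral.integral_mono_interval hz.1 hyz hy.2
    · exact Filter.Eventually.of_forall fun _ => sq_nonneg _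
    · exact Continuous.intervalIntegrable (by fun_prop) _ _
  have h3 : 0 ≤ ∫ s in z..y, f' s ^ 2 :=
    intervalIntegral.integral_nonneg hyz (fun _ _ => sq_nonneg _)
  have h4 : y - z ≤ b - a := by linarith [hz.1, hy.2]
  exact mul_le_mul h4 h2 h3 (by linarith)

lemma duality {q N : ℕ} (hN : 1 ≤ N) (x : ℕ → ℝ) (v r : ℕ → ℕ → ℝ) :
    Bp q N x r v = - Bm q N x v r := by
  have hib : ∀ n, (∫ y in (x n)..(x (n+1)), pev' q r n y * pev q v n y)
      = pev q r n (x (n+1)) * pev q v n (x (n+1)) - pev q r n (x n) * pev q v n (x n)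
        - ∫ y in (x n)..(x (n+1)), pev' q v n y * pev q r n y := by
    intro n
    have := intervalIntegral.integral_mul_deriv_eq_deriv_mul (a := x n) (b := x (n+1))
      (fun y _ => pev_deriv q v n y) (fun y _ => pev_deriv q r n y)
      ((pev'_cont q v n).intervalIntegrable _ _) ((pev'_cont q r n).intervalIntegrable _ _)
    have h2 : ∀ y, pev' q r n y * pev q v n y = pev q v n y * pev' q r n y := fun y => mul_comm _ _
    simp only [h2]; rw [this]; ring
  unfold Bp Bm
  simp only [hib, Finset.sum_sub_distrib]
  have hs := sum_prv hN (fun n => pev q r n (x (n+1)) * pev q v n (x (n+1)))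
  rw [← hs]
  have : ∀ n, jmp q N x r n * valR q x v n
      = pev q r (prv N n) (x (prv N n +1)) * pev q v n (x n) - pev q r n (x n) * pev q v n (x n) := by
    intro n; simp only [jmp, valL_eq hN, valR]; ring
  have h3 : ∀ n, jmp q N x v n * valL q N x r n
      = pev q r (prv N n) (x (prv N n +1)) * pev q v (prv N n) (x (prv N n + 1))
       - pev q r (prv N n) (x (prv N n +1)) * pev q v n (x n) := by
    intro n; simp only [jmp, valL_eq hN, valR]; ring
  simp only [this, h3, Finset.sum_sub_distrib]
  ring

lemma young_int {a b h : ℝ} (hab : a ≤ b) (hh : 0 < h) {f g : ℝ → ℝ}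
    (hf : Continuous f) (hg : Continuous g) (α : ℝ) (hα : 0 < α) :
    ∫ y in a..b, f y * g y ≤ α * (h^2 * ∫ y in a..b, f y ^ 2)
      + (1/(4*α)) * ((∫ y in a..b, g y ^2) / h^2) := by
  have h1 : α * (h^2 * ∫ y in a..b, f y ^ 2) + (1/(4*α)) * ((∫ y in a..b, g y ^2) / h^2)
      = ∫ y in a..b, ((α * h^2) * f y ^ 2 + (1/(4*α*h^2)) * g y ^ 2) := by
    rw [intervalIntegral.integral_add, intervalIntegral.integral_const_mul,
      intervalIntegral.integral_const_mul]
    · field_simp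
    all_goals exact Continuous.intervalIntegrable (by fun_prop) _ _
  rw [h1]
  apply intervalIntegral.integral_mono_on hab
  · exact Continuous.intervalIntegrable (by fun_prop) _ _
  · exact Continuous.intervalIntegrable (by fun_prop) _ _
  intro y _
  have : (α * h^2) * f y ^ 2 + (1/(4*α*h^2)) * g y ^ 2 - f y * g y
      = (1/(4*α*h^2)) * (2*α*h^2 * f y - g y)^2 := by field_simp; ring
  have h3 : 0 ≤ (1/(4*α*h^2)) * (2*α*h^2 * f y - g y)^2 := by positivity
  linarith

/-- The inverse-estimate property for the constant `K`. -/
def Inv (q : ℕ) (K : ℝ) : Prop := ∀ (c : ℕ → ℕ → ℝ) (n : ℕ) (a b : ℝ), a < b →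
    (∀ y ∈ Icc a b, (b - a) * pev q c n y ^ 2 ≤ K * ∫ y in a..b, pev q c n y ^ 2) ∧
    ((b - a)^2 * ∫ y in a..b, pev' q c n y ^ 2) ≤ K * ∫ y in a..b, pev q c n y ^ 2

lemma Bm_young {q N : ℕ} {x : ℕ → ℝ} {ρ K : ℝ} (hK : 0 < K) (hinv : Inv q K) (hρ : 0 ≤ ρ)
    (hp : Partition N x) (hm : MeshRatio N x ρ) (w r : ℕ → ℕ → ℝ) :
    Bm q N x w r ≤ (K + 2*K^2*(1+ρ)) * nsq q N x w + (1/2) * wRτ q N x r := by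
  have hN : 1 ≤ N := by have := hp.1; omega
  set A : ℕ → ℝ := fun n => ∫ y in (x n)..(x (n+1)), pev q w n y ^ 2 with hA
  set R : ℕ → ℝ := fun n => (∫ y in (x n)..(x (n+1)), pev q r n y ^ 2) / (hseg x n)^2 with hR
  have hnsq : nsq q N x w = ∑ n ∈ Finset.range N, A n := nsq_eq q N x w
  have hwR : wRτ q N x r = ∑ n ∈ Finset.range N, R n := rfl
  have e1 : ∀ n ∈ Finset.range N, ∫ y in (x n)..(x (n+1)), pev' q w n y * pev q r n y
      ≤ K * A n + (1/4) * R n := by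
    intro n hn
    have hn := Finset.mem_range.mp hn
    have hx := hp.2.2.2 n hn
    have h := young_int hx.le (hseg_pos hp hn) (pev'_cont q w n) (pev_cont q r n) 1 one_pos
    have h2 := (hinv w n _ _ hx).2
    simp only [hseg] at h
    simp only [hA, hR, hseg]
    linarith
  have e2 : ∀ n ∈ Finset.range N, -(jmp q N x w n * valL q N x r n)
      ≤ (2*K^2) * A (prv N n) + (2*K^2*ρ) * A n + (1/4) * R (prv N n) := by
    intro n hn
    have hn := Finset.mem_range.mp hn
    have hx := hp.2.2.2 n hn
    have hx' := hp.2.2.2 _ (prv_lt hn)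
    have hh := hseg_pos hp hn
    have hh' := hseg_pos hp (prv_lt hn)
    have hρ' := mesh_prv hm hn
    simp only [jmp, valL_eq hN, valR]
    set m := prv N n
    have a1 := (hinv w m _ _ hx').1 (x (m+1)) ⟨hx'.le, le_rfl⟩
    have a2 := (hinv w n _ _ hx).1 (x n) ⟨le_rfl, hx.le⟩
    have a3 := (hinv r m _ _ hx').1 (x (m+1)) ⟨hx'.le, le_rfl⟩
    have hRm : (∫ y in (x m)..(x (m+1)), pev q r m y ^ 2) = R m * (hseg x m)^2 := by
      simp only [hR]; field_simp
    rw [hRm] at a3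
    change hseg x m * _ ≤ _ at a1
    change hseg x n * _ ≤ _ at a2
    change hseg x m * _ ≤ _ at a3
    change _ ≤ K * A m at a1
    change _ ≤ K * A n at a2
    set p := pev q w m (x (m+1))
    set s := pev q w n (x n)
    set z := pev q r m (x (m+1))
    set h := hseg x m
    set h' := hseg x n
    have a3' : z^2 ≤ K * R m * h := by
      have : h * z^2 ≤ h * (K * R m * h) := by linarith
      exact le_of_mul_le_mul_left this hh'
    have b1 : -((p - s) * z) ≤ K * h * (p-s)^2 + (1/(4*K*h)) * z^2 := by
      have : K * h * (p-s)^2 + (1/(4*K*h)) * z^2 + (p-s)*z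
        = (1/(4*K*h)) * (2*K*h*(p-s) + z)^2 := by field_simp; ring
      have : 0 ≤ (1/(4*K*h)) * (2*K*h*(p-s) + z)^2 := by positivity
      linarith
    have b2 : (1/(4*K*h)) * z^2 ≤ (1/4) * R m := by
      calc (1/(4*K*h)) * z^2 ≤ (1/(4*K*h)) * (K * R m * h) := by gcongr
        _ = _ := by field_simp
    have b3 : h * (p-s)^2 ≤ 2 * (K * A m) + 2 * (ρ * (K * A n)) := by
      have c1 : h * (p-s)^2 ≤ 2 * (h * p^2) + 2 * (h * s^2) := by
        nlinarith [mul_nonneg hh'.le (sq_nonneg (p+s))]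
      have c2 : h * s^2 ≤ ρ * h' * s^2 := by gcongr
      have c3 : ρ * h' * s^2 ≤ ρ * (K * A n) := by
        rw [mul_assoc]; gcongr
      linarith
    have b4 := mul_le_mul_of_nonneg_left b3 hK.le
    nlinarith
  have s1 := Finset.sum_le_sum e1
  have s2 := Finset.sum_le_sum e2
  simp only [Finset.sum_add_distrib, ← Finset.mul_sum, Finset.sum_neg_distrib] at s1 s2
  rw [sum_prv hN A, sum_prv hN R] at s2
  unfold Bm
  rw [hnsq, hwR]
  nlinarith

lemma pev_smul (q : ℕ) (s : ℕ → ℝ) (c : ℕ → ℕ → ℝ) (n : ℕ) (y : ℝ) :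
    pev q (fun n k => s n * c n k) n y = s n * pev q c n y := by
  unfold pev; rw [Finset.mul_sum]; simp only [mul_assoc]

/-- weighted bound on the discrete gradient -/
lemma grad_bound {q N : ℕ} {x : ℕ → ℝ} {ρ K : ℝ} (hK : 0 < K) (hinv : Inv q K) (hρ : 0 ≤ ρ)
    (hp : Partition N x) (hm : MeshRatio N x ρ) (w g : ℕ → ℕ → ℝ) (hg : IsGminus q N x w g) :
    ∑ n ∈ Finset.range N, (hseg x n)^2 * ∫ y in (x n)..(x (n+1)), pev q g n y ^ 2
      ≤ 2 * ((K + 2*K^2*(1+ρ)) * nsq q N x w) := by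
  set r : ℕ → ℕ → ℝ := fun n k => (hseg x n)^2 * g n k with hr
  have hpr : ∀ n y, pev q r n y = (hseg x n)^2 * pev q g n y :=
    fun n y => pev_smul q (fun n => (hseg x n)^2) g n y
  have h1 := Bm_young hK hinv hρ hp hm w r
  rw [← hg r] at h1
  have h2 : inner2 q N x g r
      = ∑ n ∈ Finset.range N, (hseg x n)^2 * ∫ y in (x n)..(x (n+1)), pev q g n y ^ 2 := by
    unfold inner2
    apply Finset.sum_congr rfl; intro n _
    rw [← intervalIntegral.integral_const_mul]
    congr 1; ext y; rw [hpr]; ring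
  have h3 : wRτ q N x r
      = ∑ n ∈ Finset.range N, (hseg x n)^2 * ∫ y in (x n)..(x (n+1)), pev q g n y ^ 2 := by
    unfold wRτ
    apply Finset.sum_congr rfl; intro n hn
    have hh := hseg_pos hp (Finset.mem_range.mp hn)
    simp only [hpr, mul_pow]
    rw [intervalIntegral.integral_const_mul]
    field_simp
  rw [h2, h3] at h1
  linarith

end DGaux

namespace DGaux
open DG

lemma poincare {q N : ℕ} {x : ℕ → ℝ} (hp : Partition N x) (w : ℕ → ℕ → ℝ)
    {n : ℕ} (hn : n < N) {y : ℝ} (hy : y ∈ Icc (x n) (x (n+1))) :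
    (pev q w n y - intg q N x w) ^ 2 ≤ 8 * dGsq q N x w := by
  have hN : 1 ≤ N := by have := hp.1; omega
  set P : ℕ → ℝ := fun n => ∫ y in (x n)..(x (n+1)), pev' q w n y ^ 2 with hP
  set D : ℕ → ℝ := fun n => Real.sqrt (hseg x n * P n) with hD
  set J : ℕ → ℝ := fun n => |jmp q N x w n| with hJ
  set p0 := pev q w 0 (x 0)
  set V := ∑ i ∈ Finset.range N, (D i + J i) with hV
  have hD0 : ∀ i, 0 ≤ D i := fun i => Real.sqrt_nonneg _
  have hJ0 : ∀ i, 0 ≤ J i := fun i => abs_nonneg _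
  have hcell : ∀ m < N, ∀ y ∈ Icc (x m) (x (m+1)), ∀ z ∈ Icc (x m) (x (m+1)),
      |pev q w m y - pev q w m z| ≤ D m := by
    intro m hm y hy z hz
    apply Real.abs_le_sqrt
    exact ftc_sq (pev'_cont q w m) (pev_deriv q w m) hy hz
  have hnode : ∀ m, m < N → |pev q w m (x m) - p0| ≤
      ∑ i ∈ Finset.range m, D i + ∑ i ∈ Finset.range (m+1), J i := by
    intro m
    induction m with
    | zero => intro _; simp [p0, hJ0]
    | succ m ih =>
      intro hm
      have h1 := ih (by omega)
      have hx := hp.2.2.2 m (by omega)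
      have h2 := hcell m (by omega) (x (m+1)) ⟨hx.le, le_rfl⟩ (x m) ⟨le_rfl, hx.le⟩
      have h3 : J (m+1) = |pev q w m (x (m+1)) - pev q w (m+1) (x (m+1))| := by
        simp only [hJ, jmp, valL_eq hN, valR, prv]; simp
      rw [Finset.sum_range_succ D, Finset.sum_range_succ J, h3]
      rw [abs_le] at *
      have h4 := neg_abs_le (pev q w m (x (m+1)) - pev q w (m+1) (x (m+1)))
      have h5 := le_abs_self (pev q w m (x (m+1)) - pev q w (m+1) (x (m+1)))
      constructor <;> linarith
  have hpt : ∀ m < N, ∀ y ∈ Icc (x m) (x (m+1)), |pev q w m y - p0| ≤ V := by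
    intro m hm y hy
    have hx := hp.2.2.2 m hm
    have h1 := hnode m hm
    have h2 := hcell m hm y hy (x m) ⟨le_rfl, hx.le⟩
    have h3 : ∑ i ∈ Finset.range (m+1), (D i + J i) ≤ V := by
      apply Finset.sum_le_sum_of_subset_of_nonneg
      · intro i hi; simp only [Finset.mem_range] at *; omega
      · intro i _ _; exact add_nonneg (hD0 i) (hJ0 i)
    rw [Finset.sum_add_distrib, Finset.sum_range_succ D] at h3
    rw [abs_le] at *
    constructor <;> linarith
  have hmean : |intg q N x w - p0| ≤ V := by
    have h1 : intg q N x w - p0 = ∑ n ∈ Finset.range N, ∫ y in (x n)..(x (n+1)), (pev q w n y - p0) := by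
      have : ∀ n, ∫ y in (x n)..(x (n+1)), (pev q w n y - p0)
          = (∫ y in (x n)..(x (n+1)), pev q w n y) - hseg x n * p0 := by
        intro n
        rw [intervalIntegral.integral_sub ((pev_cont q w n).intervalIntegrable _ _)
          (by simp), intervalIntegral.integral_const, smul_eq_mul, hseg]
      simp only [this, Finset.sum_sub_distrib, ← Finset.sum_mul, sum_hseg hp, intg, one_mul]
    rw [h1]
    calc _ ≤ ∑ n ∈ Finset.range N, |∫ y in (x n)..(x (n+1)), (pev q w n y - p0)| :=
          Finset.abs_sum_le_sum_abs _ _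
      _ ≤ ∑ n ∈ Finset.range N, V * hseg x n := by
          apply Finset.sum_le_sum; intro n hn
          have hn := Finset.mem_range.mp hn
          have hx := hp.2.2.2 n hn
          have := intervalIntegral.norm_integral_le_of_norm_le_const (a := x n) (b := x (n+1))
            (f := fun y => pev q w n y - p0) (C := V) (by
              intro y hy
              rw [uIoc_of_le hx.le] at hy
              exact hpt n hn y ⟨hy.1.le, hy.2⟩)
          rwa [Real.norm_eq_abs, abs_of_pos (by linarith : 0 < x (n+1) - x n)] at this
      _ = V := by rw [← Finset.mul_sum, sum_hseg hp, mul_one]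
  have hV2 : V^2 ≤ 2 * dGsq q N x w := by
    set H : ℕ → ℝ := fun n => (hprev N x n + hseg x n) / 2 with hH
    have hHpos : ∀ n < N, 0 < H n := by
      intro n hn
      have := hseg_pos hp hn
      have := hseg_pos hp (prv_lt hn)
      simp only [hH, hprev_eq]; linarith
    have hHsum : ∑ n ∈ Finset.range N, H n = 1 := by
      simp only [hH, hprev_eq]
      rw [← Finset.sum_div, Finset.sum_add_distrib, sum_prv hN (hseg x), sum_hseg hp]; norm_num
    have h1 : (∑ n ∈ Finset.range N, D n)^2
        ≤ (∑ n ∈ Finset.range N, hseg x n) * ∑ n ∈ Finset.range N, P n := by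
      apply Finset.sum_sq_le_sum_mul_sum_of_sq_le_mul
      · intro i hi; exact (hseg_pos hp (Finset.mem_range.mp hi)).le
      · intro i hi; exact cell_nonneg hp (Finset.mem_range.mp hi) _
      · intro i hi
        exact le_of_eq <| Real.sq_sqrt (mul_nonneg (hseg_pos hp (Finset.mem_range.mp hi)).le
          (cell_nonneg hp (Finset.mem_range.mp hi) _))
    have h2 : (∑ n ∈ Finset.range N, J n)^2
        ≤ (∑ n ∈ Finset.range N, H n) * ∑ n ∈ Finset.range N, (J n)^2 / H n := by
      apply Finset.sum_sq_le_sum_mul_sum_of_sq_le_mul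
      · intro i hi; exact (hHpos i (Finset.mem_range.mp hi)).le
      · intro i hi; exact div_nonneg (sq_nonneg _) (hHpos i (Finset.mem_range.mp hi)).le
      · intro i hi
        have := (hHpos i (Finset.mem_range.mp hi)).ne'
        apply le_of_eq
        field_simp
    rw [sum_hseg hp, one_mul] at h1
    rw [hHsum, one_mul] at h2
    have h3 : dGsq q N x w = ∑ n ∈ Finset.range N, P n + ∑ n ∈ Finset.range N, (J n)^2 / H n := by
      rw [← Finset.sum_add_distrib]
      unfold dGsq
      apply Finset.sum_congr rfl
      intro n hn
      have := hHpos n (Finset.mem_range.mp hn)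
      simp only [hH] at this
      simp only [hP, hJ, hH, sq_abs]
      congr 1
      field_simp
    rw [hV, Finset.sum_add_distrib, h3]
    nlinarith [sq_nonneg (∑ n ∈ Finset.range N, D n - ∑ n ∈ Finset.range N, J n)]
  have hfin : |pev q w n y - intg q N x w| ≤ 2 * V := by
    have := hpt n hn y hy
    rw [abs_le] at *
    constructor <;> linarith
  calc (pev q w n y - intg q N x w) ^ 2 ≤ (2*V)^2 := sq_le_sq' (abs_le.mp hfin).1 (abs_le.mp hfin).2
    _ ≤ _ := by nlinarith

def cst (c : ℕ → ℝ) : ℕ → ℕ → ℝ := fun n k => if k = 0 then c n else 0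

lemma pev_cst (q : ℕ) (c : ℕ → ℝ) (n : ℕ) (y : ℝ) : pev q (cst c) n y = c n := by
  unfold pev cst
  rw [Finset.sum_range_succ']
  simp

lemma Bm_cst {q N : ℕ} (hN : 1 ≤ N) (x : ℕ → ℝ) (w : ℕ → ℕ → ℝ) (c : ℕ → ℝ) :
    Bm q N x w (cst c) = ∑ n ∈ Finset.range N, (c (prv N n) - c n) * pev q w n (x n) := by
  have hib : ∀ n, (∫ y in (x n)..(x (n+1)), pev' q w n y * pev q (cst c) n y)
      = c n * pev q w n (x (n+1)) - c n * pev q w n (x n) := by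
    intro n
    simp only [pev_cst]
    rw [intervalIntegral.integral_mul_const,
      intervalIntegral.integral_eq_sub_of_hasDerivAt (fun y _ => pev_deriv q w n y)
      ((pev'_cont q w n).intervalIntegrable _ _)]
    ring
  unfold Bm
  simp only [hib]
  simp only [Finset.sum_sub_distrib, jmp, valL_eq hN, pev_cst, valR, sub_mul]
  have := sum_prv hN (fun n => c n * pev q w n (x (n+1)))
  rw [← this]
  have h2 : ∀ a b : ℝ, a * b = b * a := mul_comm
  have h3 : ∑ n ∈ Finset.range N, pev q w (prv N n) (x (prv N n + 1)) * c (prv N n)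
    = ∑ n ∈ Finset.range N, c (prv N n) * pev q w (prv N n) (x (prv N n + 1)) :=
    Finset.sum_congr rfl fun _ _ => mul_comm _ _
  have h4 : ∑ n ∈ Finset.range N, pev q w n (x n) * c (prv N n)
    = ∑ n ∈ Finset.range N, c (prv N n) * pev q w n (x n) :=
    Finset.sum_congr rfl fun _ _ => mul_comm _ _
  rw [h3, h4]
  ring

lemma Wterm {q N : ℕ} {x : ℕ → ℝ} {K : ℝ} (hinv : Inv q K)
    (hp : Partition N x) (w g : ℕ → ℕ → ℝ) (hg : IsGminus q N x w g)
    (f f' : ℕ → ℝ → ℝ) (hf' : ∀ n, Continuous (f' n)) (hf : ∀ n y, HasDerivAt (f n) (f' n y) y) :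
    ∑ n ∈ Finset.range N, ∫ y in (x n)..(x (n+1)), f n y * pev q g n y
    ≤ 2 * (∑ n ∈ Finset.range N, ∫ y in (x n)..(x (n+1)), f' n y ^ 2)
      + (1/2) * (∑ n ∈ Finset.range N, (hseg x n)^2 * ∫ y in (x n)..(x (n+1)), pev q g n y ^ 2)
      + ∑ n ∈ Finset.range N, (f (prv N n) (x (prv N n + 1)) - f n (x n))^2 / hseg x n
      + (1/2) * K * nsq q N x w := by
  have hN : 1 ≤ N := by have := hp.1; omega
  have hfc : ∀ n, Continuous (f n) := fun n =>
    continuous_iff_continuousAt.mpr fun y => (hf n y).continuousAt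
  set c : ℕ → ℝ := fun n => f n (x (n+1)) with hc
  set F : ℕ → ℝ := fun n => ∫ y in (x n)..(x (n+1)), f' n y ^ 2 with hF
  set Gg : ℕ → ℝ := fun n => (hseg x n)^2 * ∫ y in (x n)..(x (n+1)), pev q g n y ^ 2 with hGg
  set Jf : ℕ → ℝ := fun n => (f (prv N n) (x (prv N n + 1)) - f n (x n))^2 / hseg x n with hJf
  set A : ℕ → ℝ := fun n => ∫ y in (x n)..(x (n+1)), pev q w n y ^ 2 with hA
  have hsplit : ∑ n ∈ Finset.range N, ∫ y in (x n)..(x (n+1)), f n y * pev q g n y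
      = (∑ n ∈ Finset.range N, ∫ y in (x n)..(x (n+1)), pev q g n y * (f n y - c n))
        + inner2 q N x g (cst c) := by
    unfold inner2
    rw [← Finset.sum_add_distrib]
    apply Finset.sum_congr rfl; intro n _
    have := pev_cont q g n
    have := hfc n
    rw [← intervalIntegral.integral_add]
    · congr 1; ext y; rw [pev_cst]; ring
    · exact Continuous.intervalIntegrable (by fun_prop) _ _
    · have := pev_cont q (cst c) n
      exact Continuous.intervalIntegrable (by fun_prop) _ _
  rw [hsplit, hg, Bm_cst hN]
  have e1 : ∀ n ∈ Finset.range N, ∫ y in (x n)..(x (n+1)), pev q g n y * (f n y - c n)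
      ≤ (1/2) * Gg n + (1/2) * F n := by
    intro n hn
    have hn := Finset.mem_range.mp hn
    have hx := hp.2.2.2 n hn
    have hh := hseg_pos hp hn
    have := hfc n
    have h := young_int hx.le hh (pev_cont q g n) (g := fun y => f n y - c n) (by fun_prop)
      (1/2) (by norm_num)
    have h2 : (∫ y in (x n)..(x (n+1)), (f n y - c n)^2) ≤ hseg x n ^2 * F n := by
      calc _ ≤ ∫ y in (x n)..(x (n+1)), hseg x n * F n := by
            apply intervalIntegral.integral_mono_on hx.le
            · exact Continuous.intervalIntegrable (by fun_prop) _ _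
            · simp
            · intro y hy
              exact ftc_sq (hf' n) (hf n) hy ⟨hx.le, le_rfl⟩
        _ = _ := by rw [intervalIntegral.integral_const, smul_eq_mul]; simp only [hseg]; ring
    have h3 : (∫ y in (x n)..(x (n+1)), (f n y - c n)^2) / hseg x n ^2 ≤ F n := by
      rw [div_le_iff₀ (by positivity)]; linarith
    norm_num at h
    simp only [hGg]
    linarith
  have e2 : ∀ n ∈ Finset.range N, (c (prv N n) - c n) * pev q w n (x n)
      ≤ Jf n + F n + (1/2*K) * A n := by
    intro n hn
    have hn := Finset.mem_range.mp hn
    have hx := hp.2.2.2 n hn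
    have hh := hseg_pos hp hn
    have h1 := (hinv w n _ _ hx).1 (x n) ⟨le_rfl, hx.le⟩
    have h2 := ftc_sq (hf' n) (hf n) (a := x n) (b := x (n+1)) (y := x n) (z := x (n+1))
      ⟨le_rfl, hx.le⟩ ⟨hx.le, le_rfl⟩
    change hseg x n * _ ≤ K * A n at h1
    change _ ≤ hseg x n * F n at h2
    have hj : (f (prv N n) (x (prv N n + 1)) - f n (x n))^2 = Jf n * hseg x n := by
      simp only [hJf]; field_simp
    simp only [hc]
    set α := f (prv N n) (x (prv N n + 1))
    set β := f n (x n)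
    set δ := f n (x (n+1))
    set h := hseg x n
    set z := pev q w n (x n)
    have h3 : (α - δ)^2 ≤ 2 * (Jf n * h) + 2 * (h * F n) := by
      nlinarith [sq_nonneg ((α - β) - (β - δ))]
    have h4 : (α - δ) * z ≤ (1/(2*h)) * (α-δ)^2 + (1/2) * (h * z^2) := by
      have : (1/(2*h)) * (α-δ)^2 + (1/2) * (h * z^2) - (α-δ)*z
        = (1/(2*h)) * ((α-δ) - h * z)^2 := by field_simp; ring
      have : 0 ≤ (1/(2*h)) * ((α-δ) - h * z)^2 := by positivity
      linarith
    have h5 : (1/(2*h)) * (α-δ)^2 ≤ Jf n + F n := by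
      calc (1/(2*h)) * (α-δ)^2 ≤ (1/(2*h)) * (2 * (Jf n * h) + 2 * (h * F n)) := by gcongr
        _ = _ := by field_simp
    linarith
  have s1 := Finset.sum_le_sum e1
  have s2 := Finset.sum_le_sum e2
  simp only [Finset.sum_add_distrib, ← Finset.mul_sum] at s1 s2
  have hF0 : 0 ≤ ∑ n ∈ Finset.range N, F n :=
    Finset.sum_nonneg fun n hn => cell_nonneg hp (Finset.mem_range.mp hn) _
  rw [nsq_eq]
  linarith

end DGaux

namespace DGaux
open DG

lemma W_const (W : ℝ → ℝ) (hW : ContDiff ℝ 3 W) (R : ℝ) : ∃ L : ℝ, 0 ≤ L ∧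
    (∀ y ∈ Icc (-R) R, |deriv (deriv W) y| ≤ L) ∧
    (∀ y ∈ Icc (-R) R, ∀ z ∈ Icc (-R) R, |deriv (deriv W) y - deriv (deriv W) z| ≤ L * |y - z|) := by
  have h1 : ContDiff ℝ 2 (deriv W) := by
    have : ContDiff ℝ (2+1) W := by norm_num; exact hW
    exact (contDiff_succ_iff_deriv.mp this).2.2
  have h2 : ContDiff ℝ 1 (deriv (deriv W)) := by
    have : ContDiff ℝ (1+1) (deriv W) := by norm_num; exact h1
    exact (contDiff_succ_iff_deriv.mp this).2.2
  have h3 : Continuous (deriv (deriv (deriv W))) := h2.continuous_deriv le_rfl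
  obtain ⟨L1, hL1⟩ := (isCompact_Icc (a := -R) (b := R)).exists_bound_of_continuousOn
    h2.continuous.continuousOn
  obtain ⟨L2, hL2⟩ := (isCompact_Icc (a := -R) (b := R)).exists_bound_of_continuousOn
    h3.continuousOn
  refine ⟨max 0 (max L1 L2), le_max_left _ _, ?_, ?_⟩
  · intro y hy
    exact (hL1 y hy).trans ((le_max_left _ _).trans (le_max_right _ _))
  · intro y hy z hz
    have := (convex_Icc (-R) R).norm_image_sub_le_of_norm_deriv_le (f := deriv (deriv W))
      (C := L2) (fun w _ => (h2.differentiable one_ne_zero) w) hL2 hz hy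
    simp only [Real.norm_eq_abs] at this
    refine this.trans ?_
    gcongr
    exact (le_max_right _ _).trans (le_max_right _ _)

lemma W1_deriv (W : ℝ → ℝ) (hW : ContDiff ℝ 3 W) (y : ℝ) :
    HasDerivAt (deriv W) (deriv (deriv W) y) y := by
  have h1 : ContDiff ℝ 2 (deriv W) := by
    have : ContDiff ℝ (2+1) W := by norm_num; exact hW
    exact (contDiff_succ_iff_deriv.mp this).2.2
  exact (h1.differentiable two_ne_zero y).hasDerivAt

lemma W1_cont (W : ℝ → ℝ) (hW : ContDiff ℝ 3 W) : Continuous (deriv W) :=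
  continuous_iff_continuousAt.mpr fun y => (W1_deriv W hW y).continuousAt

lemma W2_cont (W : ℝ → ℝ) (hW : ContDiff ℝ 3 W) : Continuous (deriv (deriv W)) := by
  have h1 : ContDiff ℝ 2 (deriv W) := by
    have : ContDiff ℝ (2+1) W := by norm_num; exact hW
    exact (contDiff_succ_iff_deriv.mp this).2.2
  exact h1.continuous_deriv (by norm_num)

/-- Pointwise estimate. -/
lemma pt_est {W : ℝ → ℝ} {R L S : ℝ} (hL : 0 ≤ L)
    (hb : ∀ y ∈ Icc (-R) R, |deriv (deriv W) y| ≤ L)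
    (hl : ∀ y ∈ Icc (-R) R, ∀ z ∈ Icc (-R) R,
      |deriv (deriv W) y - deriv (deriv W) z| ≤ L * |y - z|)
    {a b p r : ℝ} (ha : a ∈ Icc (-R) R) (hb' : b ∈ Icc (-R) R) (hS : (a - b)^2 ≤ S) :
    (deriv (deriv W) a * p - deriv (deriv W) b * r)^2 ≤ 2 * L^2 * ((p - r)^2 + S * p^2) := by
  set A := deriv (deriv W) a
  set B := deriv (deriv W) b
  have h1 : B^2 ≤ L^2 := sq_le_sq' (by linarith [(abs_le.mp (hb b hb')).1]) (abs_le.mp (hb b hb')).2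
  have h2 : (A - B)^2 ≤ L^2 * S := by
    have h := hl a ha b hb'
    calc (A-B)^2 = |A-B|^2 := (sq_abs _).symm
      _ ≤ (L * |a-b|)^2 := by gcongr
      _ = L^2 * (a-b)^2 := by rw [mul_pow, sq_abs]
      _ ≤ _ := by gcongr
  have h3 : (A * p - B * r)^2 ≤ 2 * (B^2 * (p-r)^2) + 2 * ((A-B)^2 * p^2) := by
    nlinarith [sq_nonneg (B * (p-r) - (A-B) * p)]
  have h4 : B^2 * (p-r)^2 ≤ L^2 * (p-r)^2 := by gcongr
  have h5 : (A-B)^2 * p^2 ≤ L^2 * S * p^2 := by gcongr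
  linarith

lemma four_pt {W : ℝ → ℝ} (hW : ContDiff ℝ 3 W) {R L S : ℝ} (hL : 0 ≤ L)
    (hb : ∀ y ∈ Icc (-R) R, |deriv (deriv W) y| ≤ L)
    (hl : ∀ y ∈ Icc (-R) R, ∀ z ∈ Icc (-R) R,
      |deriv (deriv W) y - deriv (deriv W) z| ≤ L * |y - z|)
    {a b c d : ℝ} (ha : a ∈ Icc (-R) R) (hb' : b ∈ Icc (-R) R) (hc : c ∈ Icc (-R) R)
    (hd : d ∈ Icc (-R) R) (hS : (a - b)^2 ≤ S) (hS2 : (c - d)^2 ≤ S) :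
    ((deriv W b - deriv W a) - (deriv W d - deriv W c))^2
      ≤ 2 * L^2 * (((a - b) - (c - d))^2 + S * (a - c)^2) := by
  set H : ℝ → ℝ := fun s => deriv W (a + s * (c - a)) - deriv W (b + s * (d - b)) with hH
  have hder : ∀ s, HasDerivAt H (deriv (deriv W) (a + s * (c-a)) * (c - a)
      - deriv (deriv W) (b + s * (d-b)) * (d-b)) s := by
    intro s
    have k1 : HasDerivAt (fun s => a + s * (c-a)) (c-a) s := by
      simpa using ((hasDerivAt_id s).mul_const (c-a)).const_add a
    have k2 : HasDerivAt (fun s => b + s * (d-b)) (d-b) s := by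
      simpa using ((hasDerivAt_id s).mul_const (d-b)).const_add b
    exact ((W1_deriv W hW _).comp s k1).sub ((W1_deriv W hW _).comp s k2)
  obtain ⟨ξ, hξ, hξ'⟩ := exists_hasDerivAt_eq_slope H _ (zero_lt_one)
    (fun s _ => (hder s).continuousAt.continuousWithinAt) (fun s _ => hder s)
  have h1 : ((deriv W b - deriv W a) - (deriv W d - deriv W c)) = H 1 - H 0 := by
    simp [hH]; ring
  have conv : ∀ p r : ℝ, p ∈ Icc (-R) R → r ∈ Icc (-R) R → p + ξ * (r - p) ∈ Icc (-R) R := by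
    intro p r hp hr
    have := hξ.1; have := hξ.2
    constructor
    · nlinarith [hp.1, hr.1]
    · nlinarith [hp.2, hr.2]
  have hS3 : (a + ξ * (c-a) - (b + ξ * (d-b)))^2 ≤ S := by
    have e : a + ξ * (c-a) - (b + ξ * (d-b)) = (1-ξ) * (a-b) + ξ * (c-d) := by ring
    have h01 : 0 ≤ 1 - ξ := by linarith [hξ.2]
    have h02 : 0 ≤ ξ := hξ.1.le
    rw [e]
    have : ((1-ξ) * (a-b) + ξ * (c-d))^2
        = (1-ξ) * (a-b)^2 + ξ * (c-d)^2 - ξ * (1-ξ) * ((a-b) - (c-d))^2 := by ring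
    rw [this]
    have := mul_nonneg (mul_nonneg h02 h01) (sq_nonneg ((a-b) - (c-d)))
    nlinarith [mul_le_mul_of_nonneg_left hS h01, mul_le_mul_of_nonneg_left hS2 h02]
  have := pt_est hL hb hl (conv a c ha hc) (conv b d hb' hd) hS3 (p := c-a) (r := d-b)
  rw [h1]
  have h2 : H 1 - H 0 = deriv (deriv W) (a + ξ * (c-a)) * (c - a)
      - deriv (deriv W) (b + ξ * (d-b)) * (d-b) := by rw [hξ']; simp
  rw [h2]
  calc _ ≤ _ := this
    _ = _ := by ring

lemma pev_sub (q : ℕ) (c d : ℕ → ℕ → ℝ) (n : ℕ) (y : ℝ) :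
    pev q (fun n k => c n k - d n k) n y = pev q c n y - pev q d n y := by
  unfold pev; rw [← Finset.sum_sub_distrib]; simp only [sub_mul]

lemma pev'_sub (q : ℕ) (c d : ℕ → ℕ → ℝ) (n : ℕ) (y : ℝ) :
    pev' q (fun n k => c n k - d n k) n y = pev' q c n y - pev' q d n y := by
  unfold pev'; rw [← Finset.sum_sub_distrib]; simp only [sub_mul, mul_sub]

lemma Wfinal {q N : ℕ} {x : ℕ → ℝ} {ρ K : ℝ} (hK : 0 < K) (hinv : Inv q K) (hρ : 0 ≤ ρ)
    (hp : Partition N x) (hm : MeshRatio N x ρ) (w g : ℕ → ℕ → ℝ) (hg : IsGminus q N x w g)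
    {W : ℝ → ℝ} (hW : ContDiff ℝ 3 W) {R L B : ℝ} (hL : 0 ≤ L)
    (hb : ∀ y ∈ Icc (-R) R, |deriv (deriv W) y| ≤ L)
    (hl : ∀ y ∈ Icc (-R) R, ∀ z ∈ Icc (-R) R,
      |deriv (deriv W) y - deriv (deriv W) z| ≤ L * |y - z|)
    (u ut : ℕ → ℕ → ℝ)
    (hu : ∀ n < N, ∀ y ∈ Icc (x n) (x (n+1)), pev q u n y ∈ Icc (-R) R)
    (hut : ∀ n < N, ∀ y ∈ Icc (x n) (x (n+1)), pev q ut n y ∈ Icc (-R) R)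
    (hmean : intg q N x (fun n k => u n k - ut n k) = 0)
    (hB : dGsq q N x u ≤ B) :
    -(intW' q N x W u g - intW' q N x W ut g) ≤
      (K + 2*K^2*(1+ρ) + (1/2) * K) * nsq q N x w
      + (5+ρ) * L^2 * (1 + 8*B) * dGsq q N x (fun n k => u n k - ut n k) := by
  have hN : 1 ≤ N := by have := hp.1; omega
  set e : ℕ → ℕ → ℝ := fun n k => u n k - ut n k with he
  set S := 8 * dGsq q N x e with hS
  have hdGe := dGsq_nonneg (q := q) hp e
  have hdGu := dGsq_nonneg (q := q) hp u
  have hpe : ∀ n y, pev q e n y = pev q u n y - pev q ut n y := fun n y => pev_sub q u ut n y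
  have hpe' : ∀ n y, pev' q e n y = pev' q u n y - pev' q ut n y := fun n y => pev'_sub q u ut n y
  have hSe : ∀ n < N, ∀ y ∈ Icc (x n) (x (n+1)), (pev q u n y - pev q ut n y)^2 ≤ S := by
    intro n hn y hy
    have := poincare (q := q) hp e hn hy
    rw [hmean, sub_zero, hpe] at this
    exact this
  set f : ℕ → ℝ → ℝ := fun n y => deriv W (pev q ut n y) - deriv W (pev q u n y) with hf
  set f' : ℕ → ℝ → ℝ := fun n y => deriv (deriv W) (pev q ut n y) * pev' q ut n y
    - deriv (deriv W) (pev q u n y) * pev' q u n y with hf'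
  have hder : ∀ n y, HasDerivAt (f n) (f' n y) y := fun n y =>
    ((W1_deriv W hW _).comp y (pev_deriv q ut n y)).sub
      ((W1_deriv W hW _).comp y (pev_deriv q u n y))
  have hW2 := W2_cont W hW
  have hW1 := W1_cont W hW
  have hf'c : ∀ n, Continuous (f' n) := by
    intro n
    have := pev_cont q u n
    have := pev_cont q ut n
    have := pev'_cont q u n
    have := pev'_cont q ut n
    simp only [hf']; fun_prop
  have h0 := Wterm hinv hp w g hg f f' hf'c hder
  have hlhs : -(intW' q N x W u g - intW' q N x W ut g)
      = ∑ n ∈ Finset.range N, ∫ y in (x n)..(x (n+1)), f n y * pev q g n y := by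
    unfold intW'
    rw [neg_sub, ← Finset.sum_sub_distrib]
    apply Finset.sum_congr rfl; intro n _
    have := pev_cont q u n
    have := pev_cont q ut n
    have := pev_cont q g n
    rw [← intervalIntegral.integral_sub]
    · congr 1; ext y; simp only [hf]; ring
    all_goals exact Continuous.intervalIntegrable (by fun_prop) _ _
  rw [hlhs]
  have h1 := grad_bound hK hinv hρ hp hm w g hg
  have e1 : ∀ n ∈ Finset.range N, (∫ y in (x n)..(x (n+1)), f' n y ^ 2)
      ≤ 2 * L^2 * ((∫ y in (x n)..(x (n+1)), pev' q e n y ^2)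
        + S * ∫ y in (x n)..(x (n+1)), pev' q u n y ^2) := by
    intro n hn
    have hn := Finset.mem_range.mp hn
    have hx := hp.2.2.2 n hn
    have c1 := pev'_cont q e n
    have c2 := pev'_cont q u n
    have c3 := hf'c n
    rw [← intervalIntegral.integral_const_mul S, ← intervalIntegral.integral_add,
      ← intervalIntegral.integral_const_mul]
    · apply intervalIntegral.integral_mono_on hx.le
      · exact Continuous.intervalIntegrable (by fun_prop) _ _
      · exact Continuous.intervalIntegrable (by fun_prop) _ _
      intro y hy
      have := pt_est hL hb hl (hu n hn y hy) (hut n hn y hy) (hSe n hn y hy)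
        (p := pev' q u n y) (r := pev' q ut n y)
      rw [hpe']
      simp only [hf']
      linarith
    all_goals exact Continuous.intervalIntegrable (by fun_prop) _ _
  have e2 : ∀ n ∈ Finset.range N, (f (prv N n) (x (prv N n + 1)) - f n (x n))^2 / hseg x n
      ≤ (1+ρ) * L^2 * (2 * (jmp q N x e n)^2 / (hprev N x n + hseg x n)
        + S * (2 * (jmp q N x u n)^2 / (hprev N x n + hseg x n))) := by
    intro n hn
    have hn := Finset.mem_range.mp hn
    have hx := hp.2.2.2 n hn
    have hx' := hp.2.2.2 _ (prv_lt hn)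
    have hh := hseg_pos hp hn
    have hh' := hseg_pos hp (prv_lt hn)
    have hρ' := mesh_prv hm hn
    rw [hprev_eq]
    simp only [jmp, valL_eq hN, valR, hpe, hf]
    have m1 : x (prv N n + 1) ∈ Icc (x (prv N n)) (x (prv N n + 1)) := ⟨hx'.le, le_rfl⟩
    have m2 : x n ∈ Icc (x n) (x (n+1)) := ⟨le_rfl, hx.le⟩
    have := four_pt hW hL hb hl (hu _ (prv_lt hn) _ m1) (hut _ (prv_lt hn) _ m1)
      (hu _ hn _ m2) (hut _ hn _ m2) (hSe _ (prv_lt hn) _ m1) (hSe _ hn _ m2)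
    set X := ((deriv W (pev q ut (prv N n) (x (prv N n + 1))) - deriv W (pev q u (prv N n) (x (prv N n + 1)))) - (deriv W (pev q ut n (x n)) - deriv W (pev q u n (x n))))^2
    set Y1 := ((pev q u (prv N n) (x (prv N n + 1)) - pev q ut (prv N n) (x (prv N n + 1))) - (pev q u n (x n) - pev q ut n (x n)))^2
    set Y2 := (pev q u (prv N n) (x (prv N n + 1)) - pev q u n (x n))^2
    have hY : 0 ≤ Y1 + S * Y2 := by
      have : 0 ≤ S := by positivity
      positivity
    set h := hseg x n
    set h' := hseg x (prv N n)
    have e3 : (1+ρ) * L^2 * (2 * Y1 / (h' + h) + S * (2 * Y2 / (h'+h)))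
        = 2 * L^2 * (Y1 + S * Y2) * ((1+ρ) / (h'+h)) := by field_simp
    have e4 : 1 / h ≤ (1+ρ)/(h'+h) := by
      rw [div_le_div_iff₀ hh (by linarith)]
      linarith
    rw [e3, div_eq_mul_one_div X]
    have hY' : 0 ≤ 2 * L^2 * (Y1 + S * Y2) := by positivity
    exact mul_le_mul this e4 (by positivity) hY'
  have s1 := Finset.sum_le_sum e1
  have s2 := Finset.sum_le_sum e2
  simp only [Finset.sum_add_distrib, ← Finset.mul_sum] at s1 s2
  have hd : ∀ c, dGsq q N x c = (∑ n ∈ Finset.range N, ∫ y in (x n)..(x (n+1)), pev' q c n y ^2)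
      + ∑ n ∈ Finset.range N, 2 * (jmp q N x c n)^2 / (hprev N x n + hseg x n) := by
    intro c; unfold dGsq; rw [Finset.sum_add_distrib]
  have hI0 : ∀ c, 0 ≤ ∑ n ∈ Finset.range N, ∫ y in (x n)..(x (n+1)), pev' q c n y ^2 := fun c =>
    Finset.sum_nonneg fun n hn => cell_nonneg hp (Finset.mem_range.mp hn) _
  have hJ0 : ∀ c, 0 ≤ ∑ n ∈ Finset.range N, 2 * (jmp q N x c n)^2 / (hprev N x n + hseg x n) :=
    fun c => Finset.sum_nonneg fun n hn => by
      have hn := Finset.mem_range.mp hn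
      have hh := hseg_pos hp hn
      have hh' := hseg_pos hp (prv_lt hn)
      rw [hprev_eq]; positivity
  have hS0 : 0 ≤ S := by positivity
  have t1 : (∑ n ∈ Finset.range N, ∫ y in (x n)..(x (n+1)), f' n y ^ 2)
      ≤ 2 * L^2 * (dGsq q N x e + S * dGsq q N x u) := by
    refine s1.trans ?_
    have i1 := hd e; have i2 := hd u
    have i3 := hJ0 e; have i4 := hJ0 u
    gcongr <;> linarith
  have t2 : (∑ n ∈ Finset.range N, (f (prv N n) (x (prv N n + 1)) - f n (x n))^2 / hseg x n)
      ≤ (1+ρ) * L^2 * (dGsq q N x e + S * dGsq q N x u) := by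
    refine s2.trans ?_
    have i1 := hd e; have i2 := hd u
    have i3 := hI0 e; have i4 := hI0 u
    gcongr <;> linarith
  have t3 : dGsq q N x e + S * dGsq q N x u ≤ (1 + 8*B) * dGsq q N x e := by
    have : S * dGsq q N x u ≤ S * B := by gcongr
    simp only [hS] at this ⊢
    linarith
  have t4 : (5+ρ) * L^2 * (dGsq q N x e + S * dGsq q N x u)
      ≤ (5+ρ) * L^2 * ((1 + 8*B) * dGsq q N x e) := by gcongr
  linarith

end DGaux

namespace DGaux
open DG Filter Topology

lemma inner2_expand (q N : ℕ) (x : ℕ → ℝ) (c d : ℕ → ℕ → ℝ) :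
    inner2 q N x c d = ∑ n ∈ Finset.range N, ∑ i ∈ Finset.range (q+1), ∑ j ∈ Finset.range (q+1),
      c n i * d n j * ∫ y in (x n)..(x (n+1)), y ^ (i+j) := by
  unfold inner2 pev
  apply Finset.sum_congr rfl; intro n _
  simp only [Finset.sum_mul_sum]
  rw [intervalIntegral.integral_finsetSum
    (fun i _ => Continuous.intervalIntegrable (by fun_prop) _ _)]
  apply Finset.sum_congr rfl; intro i _
  rw [intervalIntegral.integral_finsetSum
    (fun i _ => Continuous.intervalIntegrable (by fun_prop) _ _)]
  apply Finset.sum_congr rfl; intro j _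
  rw [← intervalIntegral.integral_const_mul]
  congr 1; ext y; ring

lemma inner2_comm (q N : ℕ) (x : ℕ → ℝ) (c d : ℕ → ℕ → ℝ) :
    inner2 q N x c d = inner2 q N x d c := by
  unfold inner2; simp only [mul_comm]

lemma inner2_sub_left (q N : ℕ) (x : ℕ → ℝ) (c c' d : ℕ → ℕ → ℝ) :
    inner2 q N x (fun n k => c n k - c' n k) d = inner2 q N x c d - inner2 q N x c' d := by
  simp only [inner2_expand, ← Finset.sum_sub_distrib, sub_mul]

lemma inner2_sub_right (q N : ℕ) (x : ℕ → ℝ) (c d d' : ℕ → ℕ → ℝ) :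
    inner2 q N x c (fun n k => d n k - d' n k) = inner2 q N x c d - inner2 q N x c d' := by
  simp only [inner2_expand, ← Finset.sum_sub_distrib, sub_mul, mul_sub]

lemma inner2_zero_left (q N : ℕ) (x : ℕ → ℝ) (d : ℕ → ℕ → ℝ) :
    inner2 q N x (fun _ _ => 0) d = 0 := by
  simp [inner2_expand]

lemma jmp_sub (q N : ℕ) (x : ℕ → ℝ) (c d : ℕ → ℕ → ℝ) (n : ℕ) :
    jmp q N x (fun n k => c n k - d n k) n = jmp q N x c n - jmp q N x d n := by
  unfold jmp valL valR; split_ifs <;> simp only [pev_sub] <;> ring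

lemma Bm_sub (q N : ℕ) (x : ℕ → ℝ) (c d Ψ : ℕ → ℕ → ℝ) :
    Bm q N x (fun n k => c n k - d n k) Ψ = Bm q N x c Ψ - Bm q N x d Ψ := by
  have h : ∀ n, (∫ y in (x n)..(x (n+1)), pev' q (fun n k => c n k - d n k) n y * pev q Ψ n y)
      = (∫ y in (x n)..(x (n+1)), pev' q c n y * pev q Ψ n y)
        - ∫ y in (x n)..(x (n+1)), pev' q d n y * pev q Ψ n y := by
    intro n
    have := pev'_cont q c n
    have := pev'_cont q d n
    have := pev_cont q Ψ n
    rw [← intervalIntegral.integral_sub]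
    · congr 1; ext y; rw [pev'_sub]; ring
    all_goals exact Continuous.intervalIntegrable (by fun_prop) _ _
  unfold Bm
  simp only [h, jmp_sub, sub_mul, Finset.sum_sub_distrib]
  ring

lemma intg_eq (q N : ℕ) (x : ℕ → ℝ) (c : ℕ → ℕ → ℝ) :
    intg q N x c = inner2 q N x c (cst fun _ => 1) := by
  unfold intg inner2; simp only [pev_cst, mul_one]

lemma inner2_deriv {q N : ℕ} {x : ℕ → ℝ} {S : Set ℝ} {t : ℝ} {z w : ℝ → ℕ → ℕ → ℝ}
    {z' w' : ℕ → ℕ → ℝ}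
    (hz : ∀ n k, HasDerivWithinAt (fun r => z r n k) (z' n k) S t)
    (hw : ∀ n k, HasDerivWithinAt (fun r => w r n k) (w' n k) S t) :
    HasDerivWithinAt (fun r => inner2 q N x (z r) (w r))
      (inner2 q N x z' (w t) + inner2 q N x (z t) w') S t := by
  simp only [inner2_expand, ← Finset.sum_add_distrib]
  refine HasDerivWithinAt.fun_sum fun n _ => HasDerivWithinAt.fun_sum fun i _ =>
    HasDerivWithinAt.fun_sum fun j _ => ?_
  have := ((hz n i).fun_mul (hw n j)).mul_const (∫ y in (x n)..(x (n+1)), y ^ (i+j))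
  rw [← add_mul]
  exact this

lemma inner2_contOn {q N : ℕ} {x : ℕ → ℝ} {S : Set ℝ} {z w : ℝ → ℕ → ℕ → ℝ}
    (hz : ∀ n k, ContinuousOn (fun r => z r n k) S)
    (hw : ∀ n k, ContinuousOn (fun r => w r n k) S) :
    ContinuousOn (fun r => inner2 q N x (z r) (w r)) S := by
  simp only [inner2_expand]
  exact continuousOn_finsetSum _ fun n _ => continuousOn_finsetSum _ fun i _ =>
    continuousOn_finsetSum _ fun j _ => ((hz n i).mul (hw n j)).mul continuousOn_const

lemma wR_contOn {q N : ℕ} {x : ℕ → ℝ} {S : Set ℝ} {z : ℝ → ℕ → ℕ → ℝ}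
    (hz : ∀ n k, ContinuousOn (fun r => z r n k) S) :
    ContinuousOn (fun r => wRτ q N x (z r)) S := by
  have h : ∀ r, wRτ q N x (z r) = inner2 q N x (z r) (fun n k => (hseg x n ^ 2)⁻¹ * z r n k) := by
    intro r
    unfold wRτ inner2
    apply Finset.sum_congr rfl; intro n _
    rw [div_eq_mul_inv, ← intervalIntegral.integral_mul_const]
    congr 1; ext y
    rw [pev_smul q (fun n => (hseg x n ^ 2)⁻¹)]; ring
  simp only [h]
  exact inner2_contOn hz fun n k => continuousOn_const.mul (hz n k)

lemma hasDeriv_vanish {S : Set ℝ} {t z' : ℝ} {z k : ℝ → ℝ} (hz : HasDerivWithinAt z z' S t)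
    (hk : ContinuousWithinAt k S t) :
    HasDerivWithinAt (fun r => (z r - z t) * k r) (z' * k t) S t := by
  rw [hasDerivWithinAt_iff_tendsto_slope] at hz ⊢
  have h1 : Tendsto k (𝓝[S \ {t}] t) (𝓝 (k t)) := hk.mono_left (nhdsWithin_mono _ sdiff_subset)
  refine (hz.mul h1).congr fun r => ?_
  simp only [slope, vsub_eq_sub, smul_eq_mul, sub_self, zero_mul, sub_zero]
  ring

/-- basis element -/
def Eb (i j : ℕ) : ℕ → ℕ → ℝ := fun n k => if n = i ∧ k = j then 1 else 0

section bil
variable {a : (ℕ → ℕ → ℝ) → (ℕ → ℕ → ℝ) → ℝ}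

lemma a_add_right (ha : SymBilin a) (c d e : ℕ → ℕ → ℝ) :
    a c (fun n k => d n k + e n k) = a c d + a c e := by
  rw [ha.1, ha.2.1, ha.1 d, ha.1 e]

lemma a_smul_right (ha : SymBilin a) (s : ℝ) (c d : ℕ → ℕ → ℝ) :
    a c (fun n k => s * d n k) = s * a c d := by
  rw [ha.1, ha.2.2, ha.1 d]

lemma a_sub_right (ha : SymBilin a) (c d e : ℕ → ℕ → ℝ) :
    a c (fun n k => d n k - e n k) = a c d - a c e := by
  have h := a_add_right ha c d (fun n k => (-1) * e n k)
  rw [a_smul_right ha] at h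
  have : (fun n k => d n k - e n k) = (fun n k => d n k + (-1) * e n k) := by
    ext n k; ring
  rw [this, h]; ring

lemma a_sub_left (ha : SymBilin a) (c d e : ℕ → ℕ → ℝ) :
    a (fun n k => d n k - e n k) c = a d c - a e c := by
  rw [ha.1, a_sub_right ha, ha.1 c, ha.1 c]

lemma a_zero_right (ha : SymBilin a) (c : ℕ → ℕ → ℝ) : a c (fun _ _ => 0) = 0 := by
  have := a_smul_right ha 0 c (fun _ _ => 0)
  simpa using this

lemma a_sum_right (ha : SymBilin a) {ι : Type} (s : Finset ι) (c : ℕ → ℕ → ℝ)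
    (f : ι → ℕ → ℕ → ℝ) :
    a c (fun n k => ∑ i ∈ s, f i n k) = ∑ i ∈ s, a c (f i) := by
  classical
  induction s using Finset.induction_on with
  | empty => simpa using a_zero_right ha c
  | insert i s hi ih =>
    simp only [Finset.sum_insert hi]
    rw [a_add_right ha, ih]

lemma a_expand (ha : SymBilin a) (N q : ℕ) (c : ℕ → ℕ → ℝ)
    (hc : ∀ Z : ℕ → ℕ → ℝ, (∀ n < N, ∀ k ≤ q, Z n k = 0) → a c Z = 0) (Z : ℕ → ℕ → ℝ) :
    a c Z = ∑ p ∈ Finset.range N ×ˢ Finset.range (q+1), Z p.1 p.2 * a c (Eb p.1 p.2) := by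
  have h1 := a_sum_right ha (Finset.range N ×ˢ Finset.range (q+1)) c
    (fun p n k => Z p.1 p.2 * Eb p.1 p.2 n k)
  simp only [a_smul_right ha] at h1
  rw [← h1, ← sub_eq_zero, ← a_sub_right ha]
  apply hc
  intro n hn k hk
  rw [sub_eq_zero, Finset.sum_product]
  rw [Finset.sum_eq_single n, Finset.sum_eq_single k]
  · simp [Eb]
  · intro j _ hj; simp [Eb, hj.symm]
  · intro h; exact absurd (Finset.mem_range.mpr (by omega)) h
  · intro i _ hi; apply Finset.sum_eq_zero; intro j _; simp [Eb, hi.symm]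
  · intro h; exact absurd (Finset.mem_range.mpr hn) h

lemma quad_deriv (ha : SymBilin a) (N q : ℕ) {S : Set ℝ} {t : ℝ} (ht : t ∈ S)
    {z : ℝ → ℕ → ℕ → ℝ} {z' : ℕ → ℕ → ℝ}
    (hz : ∀ n k, HasDerivWithinAt (fun r => z r n k) (z' n k) S t)
    (hg : ∀ r ∈ S, ∀ Z : ℕ → ℕ → ℝ, (∀ n < N, ∀ k ≤ q, Z n k = 0) → a (z r) Z = 0)
    (hc : ∀ Z, ContinuousOn (fun r => a (z r) Z) S) :
    HasDerivWithinAt (fun r => a (z r) (z r)) (2 * a (z t) z') S t := by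
  have hkey : ∀ r ∈ S, a (z r) (z r) = a (z t) (z t)
      + ∑ p ∈ Finset.range N ×ˢ Finset.range (q+1),
        (z r p.1 p.2 - z t p.1 p.2) * (a (z r) (Eb p.1 p.2) + a (z t) (Eb p.1 p.2)) := by
    intro r hr
    have h1 := a_expand ha N q (z r) (hg r hr) (fun n k => z r n k - z t n k)
    have h2 := a_expand ha N q (z t) (hg t ht) (fun n k => z r n k - z t n k)
    rw [a_sub_right ha] at h1 h2
    simp only [mul_add, Finset.sum_add_distrib]
    rw [← h1, ← h2, ha.1 (z r) (z t)]; ring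
  have hval : 2 * a (z t) z' = ∑ p ∈ Finset.range N ×ˢ Finset.range (q+1),
      z' p.1 p.2 * (a (z t) (Eb p.1 p.2) + a (z t) (Eb p.1 p.2)) := by
    rw [a_expand ha N q (z t) (hg t ht) z', Finset.mul_sum]
    apply Finset.sum_congr rfl; intros; ring
  rw [hval]
  refine HasDerivWithinAt.congr_of_mem ?_ hkey ht
  apply HasDerivWithinAt.const_add
  apply HasDerivWithinAt.fun_sum
  intro p _
  exact hasDeriv_vanish (hz p.1 p.2) (((hc _).add continuousOn_const) t ht)

end bil

/-- mean value kernel -/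
noncomputable def mvk (W : ℝ → ℝ) (a b : ℝ) : ℝ := ∫ θ in (0:ℝ)..1, deriv W (b + (a-b) * θ)

lemma mvk_cont {W : ℝ → ℝ} (hW : ContDiff ℝ 3 W) : Continuous (fun p : ℝ × ℝ => mvk W p.1 p.2) := by
  unfold mvk
  have := W1_cont W hW
  apply intervalIntegral.continuous_parametric_intervalIntegral_of_continuous'
  fun_prop

lemma mvk_eq {W : ℝ → ℝ} (hW : ContDiff ℝ 3 W) (a b : ℝ) : W a - W b = (a-b) * mvk W a b := by
  unfold mvk
  rw [intervalIntegral.mul_integral_comp_add_mul]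
  rw [intervalIntegral.integral_deriv_eq_sub]
  · simp
  · intro y _; exact hW.differentiable (by norm_num) y
  · exact (W1_cont W hW).intervalIntegrable _ _

lemma mvk_self (W : ℝ → ℝ) (b : ℝ) : mvk W b b = deriv W b := by
  simp [mvk]

lemma pev_contOn {q : ℕ} {S : Set ℝ} {z : ℝ → ℕ → ℕ → ℝ}
    (hz : ∀ n k, ContinuousOn (fun r => z r n k) S) (n : ℕ) :
    ContinuousOn (fun p : ℝ × ℝ => pev q (z p.1) n p.2) (S ×ˢ univ) := by
  unfold pev
  refine continuousOn_finsetSum _ fun k _ => ?_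
  refine ContinuousOn.mul ?_ (by fun_prop)
  exact (hz n k).comp continuousOn_fst (fun p hp => hp.1)

lemma param_contOn {q : ℕ} {S : Set ℝ} {z : ℝ → ℕ → ℕ → ℝ}
    (hz : ∀ n k, ContinuousOn (fun r => z r n k) S) (n : ℕ) {F : ℝ → ℝ → ℝ}
    (hF : Continuous (fun p : ℝ × ℝ => F p.1 p.2)) (α β : ℝ) :
    ContinuousOn (fun r => ∫ y in α..β, F (pev q (z r) n y) y) S := by
  rw [continuousOn_iff_continuous_domRestrict]
  apply intervalIntegral.continuous_parametric_intervalIntegral_of_continuous'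
  have h := pev_contOn (q := q) hz n
  have h2 : Continuous (fun p : S × ℝ => pev q (z p.1) n p.2) :=
    h.comp_continuous (f := fun p : S × ℝ => ((p.1 : ℝ), p.2)) (by fun_prop) (fun p => ⟨p.1.2, trivial⟩)
  exact hF.comp (h2.prodMk continuous_snd)

lemma intW'_contOn {q N : ℕ} {x : ℕ → ℝ} {S : Set ℝ} {z : ℝ → ℕ → ℕ → ℝ} {W : ℝ → ℝ}
    (hW : ContDiff ℝ 3 W)
    (hz : ∀ n k, ContinuousOn (fun r => z r n k) S) (Z : ℕ → ℕ → ℝ) :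
    ContinuousOn (fun r => intW' q N x W (z r) Z) S := by
  unfold intW'
  refine continuousOn_finsetSum _ fun n _ => ?_
  have h1 := W1_cont W hW
  have h2 := pev_cont q Z n
  exact param_contOn hz n (F := fun s y => deriv W s * pev q Z n y) (by fun_prop) _ _

lemma intW_deriv {q N : ℕ} {x : ℕ → ℝ} {S : Set ℝ} {t : ℝ} (ht : t ∈ S)
    {z : ℝ → ℕ → ℕ → ℝ} {z' : ℕ → ℕ → ℝ} {W : ℝ → ℝ}
    (hW : ContDiff ℝ 3 W)
    (hzc : ∀ n k, ContinuousOn (fun r => z r n k) S)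
    (hz : ∀ n k, HasDerivWithinAt (fun r => z r n k) (z' n k) S t) :
    HasDerivWithinAt (fun r => ∑ n ∈ Finset.range N, ∫ y in (x n)..(x (n+1)), W (pev q (z r) n y))
      (intW' q N x W (z t) z') S t := by
  unfold intW'
  refine HasDerivWithinAt.fun_sum fun n _ => ?_
  have hmc := mvk_cont hW
  have hkey : ∀ r, (∫ y in (x n)..(x (n+1)), W (pev q (z r) n y))
      = (∫ y in (x n)..(x (n+1)), W (pev q (z t) n y))
        + ∑ k ∈ Finset.range (q+1), (z r n k - z t n k) *
          ∫ y in (x n)..(x (n+1)), mvk W (pev q (z r) n y) (pev q (z t) n y) * y ^ k := by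
    intro r
    have c1 := pev_cont q (z r) n
    have c2 := pev_cont q (z t) n
    have c3 := hW.continuous
    have c4 : Continuous (fun y => mvk W (pev q (z r) n y) (pev q (z t) n y)) :=
      hmc.comp (c1.prodMk c2)
    simp only [← intervalIntegral.integral_const_mul]
    rw [← intervalIntegral.integral_finsetSum
      (fun i _ => Continuous.intervalIntegrable (by fun_prop) _ _),
      ← intervalIntegral.integral_add]
    · congr 1; ext y
      have h1 := mvk_eq hW (pev q (z r) n y) (pev q (z t) n y)
      have h2 : pev q (z r) n y - pev q (z t) n y
          = ∑ k ∈ Finset.range (q+1), (z r n k - z t n k) * y ^ k := by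
        unfold pev; rw [← Finset.sum_sub_distrib]; simp only [sub_mul]
      rw [← sub_eq_iff_eq_add', h1, h2, Finset.sum_mul]
      apply Finset.sum_congr rfl; intros; ring
    all_goals exact Continuous.intervalIntegrable (by fun_prop) _ _
  have hval : (∫ y in (x n)..(x (n+1)), deriv W (pev q (z t) n y) * pev q z' n y)
      = ∑ k ∈ Finset.range (q+1), z' n k *
          ∫ y in (x n)..(x (n+1)), mvk W (pev q (z t) n y) (pev q (z t) n y) * y ^ k := by
    have c2 := pev_cont q (z t) n
    have c3 := W1_cont W hW
    simp only [mvk_self, ← intervalIntegral.integral_const_mul]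
    rw [← intervalIntegral.integral_finsetSum
      (fun i _ => Continuous.intervalIntegrable (by fun_prop) _ _)]
    congr 1; ext y
    unfold pev; rw [Finset.mul_sum]
    apply Finset.sum_congr rfl; intros; ring
  rw [hval]
  refine HasDerivWithinAt.congr_of_mem ?_ (fun r _ => hkey r) ht
  apply HasDerivWithinAt.const_add
  apply HasDerivWithinAt.fun_sum
  intro k _
  refine hasDeriv_vanish (hz n k) ?_
  have c2 := pev_cont q (z t) n
  refine param_contOn hzc n (F := fun s y => mvk W s (pev q (z t) n y) * y ^ k) ?_ _ _ t ht
  have : Continuous (fun p : ℝ × ℝ => mvk W p.1 (pev q (z t) n p.2)) :=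
    hmc.comp (f := fun p : ℝ × ℝ => (p.1, pev q (z t) n p.2)) (by fun_prop)
  fun_prop

end DGaux

namespace DGaux
open DG Filter Topology

lemma le_of_deriv_nonpos {T : ℝ} {f f' : ℝ → ℝ}
    (hf : ∀ r ∈ Ico 0 T, HasDerivWithinAt f (f' r) (Ico 0 T) r)
    (hf' : ∀ r ∈ Ico 0 T, f' r ≤ 0) {t : ℝ} (ht : t ∈ Ico 0 T) : f t ≤ f 0 := by
  have hat : ∀ r ∈ Ioo 0 T, HasDerivAt f (f' r) r := fun r hr =>
    (hf r ⟨hr.1.le, hr.2⟩).hasDerivAt (Ico_mem_nhds hr.1 hr.2)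
  have hanti : AntitoneOn f (Ico 0 T) := by
    apply antitoneOn_of_deriv_nonpos (convex_Ico 0 T)
    · exact fun r hr => (hf r hr).continuousWithinAt
    · rw [interior_Ico]
      exact fun r hr => (hat r hr).differentiableAt.differentiableWithinAt
    · rw [interior_Ico]
      intro r hr
      rw [(hat r hr).deriv]
      exact hf' r ⟨hr.1.le, hr.2⟩
  exact hanti ⟨le_rfl, ht.1.trans_lt ht.2⟩ ht ht.1

lemma ftc_Ico {T : ℝ} {r : ℝ → ℝ} (hr : ContinuousOn r (Ico 0 T)) {t : ℝ} (ht : t ∈ Ico 0 T) :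
    HasDerivWithinAt (fun t => ∫ s in (0:ℝ)..t, r s) (r t) (Ico 0 T) t := by
  obtain ⟨t1, h1, h2⟩ := exists_between ht.2
  have h01 : 0 ≤ t1 := ht.1.trans h1.le
  set r1 : ℝ → ℝ := fun s => r (max 0 (min s t1)) with hr1
  have hc : Continuous r1 := by
    apply hr.comp_continuous (by fun_prop)
    intro s
    exact ⟨le_max_left _ _, max_lt (h01.trans_lt h2) ((min_le_right _ _).trans_lt h2)⟩
  have heq : ∀ s ∈ Icc 0 t1, r1 s = r s := by
    intro s hs
    simp only [hr1, min_eq_left hs.2, max_eq_right hs.1]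
  have hd : HasDerivAt (fun t => ∫ s in (0:ℝ)..t, r1 s) (r1 t) t :=
    intervalIntegral.integral_hasDerivAt_right (hc.intervalIntegrable _ _)
      (hc.stronglyMeasurableAtFilter _ _) hc.continuousAt
  rw [heq t ⟨ht.1, h1.le⟩] at hd
  have hI : ∀ s ∈ Icc 0 t1, (∫ s in (0:ℝ)..s, r s) = ∫ s in (0:ℝ)..s, r1 s := by
    intro s hs
    apply intervalIntegral.integral_congr
    intro y hy
    rw [uIcc_of_le hs.1] at hy
    exact (heq y ⟨hy.1, hy.2.trans hs.2⟩).symm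
  refine hd.hasDerivWithinAt.congr_of_eventuallyEq ?_ (hI t ⟨ht.1, h1.le⟩)
  have hn : Iio t1 ∈ 𝓝[Ico 0 T] t := mem_nhdsWithin_of_mem_nhds (Iio_mem_nhds h1)
  filter_upwards [hn, self_mem_nhdsWithin] with s hs hs'
  exact hI s ⟨hs'.1, le_of_lt hs⟩

lemma gronwall_aux {T C : ℝ} (hC : 0 ≤ C) {f f' r1 r2 : ℝ → ℝ}
    (hf : ∀ r ∈ Ico 0 T, HasDerivWithinAt f (f' r) (Ico 0 T) r)
    (h1 : ContinuousOn r1 (Ico 0 T)) (h2 : ContinuousOn r2 (Ico 0 T))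
    (p1 : ∀ t, 0 ≤ r1 t) (p2 : ∀ t, 0 ≤ r2 t)
    (hf' : ∀ r ∈ Ico 0 T, f' r ≤ C * f r + C * (r1 r + r2 r)) {t : ℝ} (ht : t ∈ Ico 0 T) :
    f t ≤ (f 0 + C * (∫ s in (0:ℝ)..t, r1 s) + C * (∫ s in (0:ℝ)..t, r2 s)) * Real.exp (C * t) := by
  have hd : ∀ r ∈ Ico 0 T, HasDerivWithinAt
      (fun t => f t * Real.exp (-(C * t)) - C * (∫ s in (0:ℝ)..t, r1 s) - C * (∫ s in (0:ℝ)..t, r2 s))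
      (f' r * Real.exp (-(C * r)) + f r * (Real.exp (-(C * r)) * (-C)) - C * r1 r - C * r2 r)
      (Ico 0 T) r := by
    intro r hr
    have he : HasDerivAt (fun t => Real.exp (-(C*t))) (Real.exp (-(C * r)) * (-C)) r := by
      have : HasDerivAt (fun t => -(C*t)) (-C) r := by
        simpa using ((hasDerivAt_id r).const_mul C).fun_neg
      exact this.exp
    exact (((hf r hr).fun_mul he.hasDerivWithinAt).fun_sub ((ftc_Ico h1 hr).const_mul C)).fun_sub
      ((ftc_Ico h2 hr).const_mul C)
  have := le_of_deriv_nonpos hd (by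
    intro r hr
    have he1 : Real.exp (-(C*r)) ≤ 1 := Real.exp_le_one_iff.mpr (by
      have := mul_nonneg hC hr.1; linarith)
    have he0 := Real.exp_pos (-(C*r))
    have k1 := mul_le_mul_of_nonneg_right (hf' r hr) he0.le
    have k2 : 0 ≤ C * (r1 r + r2 r) := mul_nonneg hC (add_nonneg (p1 r) (p2 r))
    have k3 := mul_le_mul_of_nonneg_left he1 k2
    linarith) ht
  simp only [intervalIntegral.integral_same, mul_zero, neg_zero, Real.exp_zero, mul_one, sub_zero]
    at this
  have k : f t * Real.exp (-(C*t)) ≤ f 0 + C * (∫ s in (0:ℝ)..t, r1 s) + C * (∫ s in (0:ℝ)..t, r2 s) := by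
    linarith
  have k2 := mul_le_mul_of_nonneg_right k (Real.exp_pos (C*t)).le
  rwa [mul_assoc, ← Real.exp_add, neg_add_cancel, Real.exp_zero, mul_one] at k2

lemma inner2_add_left (q N : ℕ) (x : ℕ → ℝ) (c c' d : ℕ → ℕ → ℝ) :
    inner2 q N x (fun n k => c n k + c' n k) d = inner2 q N x c d + inner2 q N x c' d := by
  simp only [inner2_expand, ← Finset.sum_add_distrib, add_mul]

lemma inner2_add_right (q N : ℕ) (x : ℕ → ℝ) (c d d' : ℕ → ℕ → ℝ) :
    inner2 q N x c (fun n k => d n k + d' n k) = inner2 q N x c d + inner2 q N x c d' := by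
  rw [inner2_comm, inner2_add_left, inner2_comm, inner2_comm q N x d']

lemma neg_inner_le {q N : ℕ} {x : ℕ → ℝ} (hp : Partition N x) (c d : ℕ → ℕ → ℝ) :
    - inner2 q N x c d ≤ (1/2) * nsq q N x c + (1/2) * nsq q N x d := by
  have h := nsq_nonneg (q := q) hp (fun n k => c n k + d n k)
  unfold nsq at *
  rw [inner2_add_left, inner2_add_right, inner2_add_right, inner2_comm q N x d c] at h
  linarith

lemma IsG_unique {q N : ℕ} {x : ℕ → ℝ} {w g g' : ℕ → ℕ → ℝ} (h : IsGminus q N x w g)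
    (h' : IsGminus q N x w g') : nsq q N x g = nsq q N x g' := by
  unfold nsq
  rw [h g, ← h' g, inner2_comm, h g', ← h' g']

lemma IsG_sub {q N : ℕ} {x : ℕ → ℝ} {w g w' g' : ℕ → ℕ → ℝ} (h : IsGminus q N x w g)
    (h' : IsGminus q N x w' g') :
    IsGminus q N x (fun n k => w n k - w' n k) (fun n k => g n k - g' n k) := by
  intro Ψ
  rw [inner2_sub_left, Bm_sub, h, h']

lemma pev_zero {q N : ℕ} {Z : ℕ → ℕ → ℝ} (hZ : ∀ n < N, ∀ k ≤ q, Z n k = 0) {n : ℕ} (hn : n < N)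
    (y : ℝ) : pev q Z n y = 0 := by
  unfold pev
  apply Finset.sum_eq_zero
  intro k hk
  rw [hZ n hn k (by have := Finset.mem_range.mp hk; omega), zero_mul]

section sol
variable {q N : ℕ} {x : ℕ → ℝ} {S : Set ℝ} {γ μ : ℝ} {W : ℝ → ℝ}
    {a : (ℕ → ℕ → ℝ) → (ℕ → ℕ → ℝ) → ℝ}
    {u u' v v' τ gv Ru Rv Rτ : ℝ → ℕ → ℕ → ℝ}

lemma sol_garb (hγ : 0 < γ) (h : SolvesPert q N x S γ μ W a u u' v v' τ gv Ru Rv Rτ) :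
    ∀ r ∈ S, ∀ Z : ℕ → ℕ → ℝ, (∀ n < N, ∀ k ≤ q, Z n k = 0) → a (u r) Z = 0 := by
  obtain ⟨-, -, -, -, -, -, -, -, -, -, -, h3⟩ := h
  intro r hr Z hZ
  have e := h3 r hr Z
  have i1 : ∀ c, inner2 q N x c Z = 0 := by
    intro c
    unfold inner2
    apply Finset.sum_eq_zero; intro n hn
    simp [pev_zero hZ (Finset.mem_range.mp hn)]
  have i2 : intW' q N x W (u r) Z = 0 := by
    unfold intW'
    apply Finset.sum_eq_zero; intro n hn
    simp [pev_zero hZ (Finset.mem_range.mp hn)]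
  rw [i1, i1, i2] at e
  have : γ * a (u r) Z = 0 := by linarith
  exact (mul_eq_zero.mp this).resolve_left hγ.ne'

lemma sol_cont (hγ : 0 < γ) (hW : ContDiff ℝ 3 W)
    (h : SolvesPert q N x S γ μ W a u u' v v' τ gv Ru Rv Rτ) (Z : ℕ → ℕ → ℝ) :
    ContinuousOn (fun r => a (u r) Z) S := by
  obtain ⟨hu, -, -, -, hτ, -, -, hR, -, -, -, h3⟩ := h
  have hc : ContinuousOn (fun r => (inner2 q N x (τ r) Z - intW' q N x W (u r) Z
      - inner2 q N x (Rτ r) Z) / γ) S := by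
    have k1 : ContinuousOn (fun r => inner2 q N x (τ r) Z) S :=
      inner2_contOn hτ (fun _ _ => continuousOn_const)
    have k2 : ContinuousOn (fun r => inner2 q N x (Rτ r) Z) S :=
      inner2_contOn hR (fun _ _ => continuousOn_const)
    have k3 : ContinuousOn (fun r => intW' q N x W (u r) Z) S :=
      intW'_contOn hW (fun n k r hr => (hu r hr n k).continuousWithinAt) Z
    exact ((k1.sub k3).sub k2).div_const γ
  refine hc.congr fun r hr => ?_
  have := h3 r hr Z
  change a (u r) Z = _
  rw [eq_div_iff hγ.ne']
  linarith
end sol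

lemma energy_split {q N : ℕ} {x : ℕ → ℝ} {γ : ℝ} {W : ℝ → ℝ} (hW : ContDiff ℝ 3 W)
    (a : (ℕ → ℕ → ℝ) → (ℕ → ℕ → ℝ) → ℝ) (u v : ℕ → ℕ → ℝ) :
    energy q N x γ W a u v = (∑ n ∈ Finset.range N, ∫ y in (x n)..(x (n+1)), W (pev q u n y))
      + (1/2) * inner2 q N x v v + (γ/2) * a u u := by
  unfold energy inner2
  rw [Finset.mul_sum, ← Finset.sum_add_distrib]
  congr 1
  apply Finset.sum_congr rfl; intro n _
  have := pev_cont q u n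
  have := pev_cont q v n
  have := hW.continuous
  rw [← intervalIntegral.integral_const_mul, ← intervalIntegral.integral_add]
  · congr 1; ext y; ring
  all_goals exact Continuous.intervalIntegrable (by fun_prop) _ _

lemma energy_le {q N : ℕ} {x : ℕ → ℝ} (hp : Partition N x) {T γ μ : ℝ} (hγ : 0 < γ) (hμ : 0 ≤ μ)
    {W : ℝ → ℝ} (hW : ContDiff ℝ 3 W) {a : (ℕ → ℕ → ℝ) → (ℕ → ℕ → ℝ) → ℝ} (ha : SymBilin a)
    {u u' v v' τ gv : ℝ → ℕ → ℕ → ℝ}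
    (h : Solves q N x (Ico 0 T) γ μ W a u u' v v' τ gv) {t : ℝ} (ht : t ∈ Ico 0 T) :
    energy q N x γ W a (u t) (v t) ≤ energy q N x γ W a (u 0) (v 0) := by
  have hN : 1 ≤ N := by have := hp.1; omega
  have hg := sol_garb hγ h
  have hcn := sol_cont hγ hW h
  obtain ⟨hu, hv, -, -, -, -, -, -, hG, h1, h2, h3⟩ := h
  have hd : ∀ r ∈ Ico 0 T, HasDerivWithinAt (fun t => energy q N x γ W a (u t) (v t))
      (intW' q N x W (u r) (u' r)
        + (1/2) * (inner2 q N x (v' r) (v r) + inner2 q N x (v r) (v' r))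
        + (γ/2) * (2 * a (u r) (u' r))) (Ico 0 T) r := by
    intro r hr
    simp only [energy_split hW]
    have d1 := intW_deriv (q := q) (N := N) (x := x) hr hW
      (fun n k r hr => (hu r hr n k).continuousWithinAt) (hu r hr)
    have d2 := inner2_deriv (q := q) (N := N) (x := x) (hv r hr) (hv r hr)
    have d3 := quad_deriv ha N q hr (hu r hr) hg hcn
    exact (d1.fun_add (d2.const_mul (1/2))).fun_add (d3.const_mul (γ/2))
  refine le_of_deriv_nonpos hd ?_ ht
  intro r hr
  have e1 := h1 r hr (τ r)
  have e2 := h2 r hr (v r) (gv r) (hG r hr)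
  have e3 := h3 r hr (u' r)
  have hn := nsq_nonneg (q := q) hp (gv r)
  rw [inner2_zero_left] at e1 e2 e3
  rw [duality hN] at e2
  rw [inner2_comm q N x (τ r)] at e3
  rw [inner2_comm q N x (v r) (v' r)]
  unfold nsq at hn
  have := mul_nonneg hμ hn
  linarith

lemma mean_const {q N : ℕ} {x : ℕ → ℝ} (hp : Partition N x) {T : ℝ}
    {u u' v : ℝ → ℕ → ℕ → ℝ}
    (hu : ∀ t ∈ Ico 0 T, ∀ n k, HasDerivWithinAt (fun r => u r n k) (u' t n k) (Ico 0 T) t)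
    (h1 : ∀ t ∈ Ico 0 T, ∀ Φ : ℕ → ℕ → ℝ, inner2 q N x (u' t) Φ = Bm q N x (v t) Φ)
    {t : ℝ} (ht : t ∈ Ico 0 T) : intg q N x (u t) = intg q N x (u 0) := by
  have hN : 1 ≤ N := by have := hp.1; omega
  have hd : ∀ r ∈ Ico 0 T, HasDerivWithinAt (fun t => intg q N x (u t)) 0 (Ico 0 T) r := by
    intro r hr
    simp only [intg_eq]
    have d := inner2_deriv (q := q) (N := N) (x := x) (hu r hr)
      (w := fun _ => cst fun _ => 1) (w' := fun _ _ => 0)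
      (fun n k => hasDerivWithinAt_const _ _ _)
    rw [h1 r hr, Bm_cst hN, inner2_comm q N x (u r), inner2_zero_left] at d
    simpa using d
  apply le_antisymm
  · exact le_of_deriv_nonpos hd (fun _ _ => le_rfl) ht
  · have hd2 : ∀ r ∈ Ico 0 T, HasDerivWithinAt (fun t => -intg q N x (u t)) 0 (Ico 0 T) r := by
      intro r hr; simpa using (hd r hr).fun_neg
    have := le_of_deriv_nonpos hd2 (fun _ _ => le_rfl) ht
    linarith

lemma mean_bd {q N : ℕ} {x : ℕ → ℝ} (hp : Partition N x) (w : ℕ → ℕ → ℝ) {V : ℝ}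
    (hV : ∀ n < N, ∀ y ∈ Icc (x n) (x (n+1)), |pev q w n y| ≤ V) : |intg q N x w| ≤ V := by
  unfold intg
  calc _ ≤ ∑ n ∈ Finset.range N, |∫ y in (x n)..(x (n+1)), pev q w n y| :=
        Finset.abs_sum_le_sum_abs _ _
    _ ≤ ∑ n ∈ Finset.range N, V * hseg x n := by
        apply Finset.sum_le_sum; intro n hn
        have hn := Finset.mem_range.mp hn
        have hx := hp.2.2.2 n hn
        have := intervalIntegral.norm_integral_le_of_norm_le_const (a := x n) (b := x (n+1))
          (f := fun y => pev q w n y) (C := V) (by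
            intro y hy
            rw [uIoc_of_le hx.le] at hy
            exact hV n hn y ⟨hy.1.le, hy.2⟩)
        rwa [Real.norm_eq_abs, abs_of_pos (by linarith : 0 < x (n+1) - x n)] at this
    _ = V := by rw [← Finset.mul_sum, sum_hseg hp, mul_one]

end DGaux

namespace DGaux
open DG Filter Topology

section fin
variable {q N : ℕ} {x : ℕ → ℝ} {T γ μ : ℝ} {W : ℝ → ℝ}
    {a : (ℕ → ℕ → ℝ) → (ℕ → ℕ → ℝ) → ℝ}
    {u u' v v' τ gv ut ut' vt vt' τt gvt Rv Rτ : ℝ → ℕ → ℕ → ℝ}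

lemma G_of_sol {S : Set ℝ} {Rv Rτ : ℝ → ℕ → ℕ → ℝ}
    (h : SolvesPert q N x S γ μ W a u u' v v' τ gv (fun _ _ _ => 0) Rv Rτ) {t : ℝ} (ht : t ∈ S) :
    IsGminus q N x (v t) (u' t) := by
  obtain ⟨-, -, -, -, -, -, -, -, -, h1, -, -⟩ := h
  intro Φ
  have := h1 t ht Φ
  rw [inner2_zero_left] at this
  linarith

lemma eta_deriv (hγ : 0 < γ) (hW : ContDiff ℝ 3 W) (ha : SymBilin a)
    (h : Solves q N x (Ico 0 T) γ μ W a u u' v v' τ gv)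
    (h' : SolvesPert q N x (Ico 0 T) γ μ W a ut ut' vt vt' τt gvt (fun _ _ _ => 0) Rv Rτ)
    {t : ℝ} (ht : t ∈ Ico 0 T) :
    HasDerivWithinAt (etaR q N x γ μ a u v gv ut vt gvt)
      ((1/2) * (inner2 q N x (dsub v' vt' t) (dsub v vt t) + inner2 q N x (dsub v vt t) (dsub v' vt' t))
        + (γ/2) * (2 * a (dsub u ut t) (dsub u' ut' t))
        + (μ/4) * nsq q N x (dsub gv gvt t)) (Ico 0 T) t := by
  have g1 := sol_garb hγ h
  have g2 := sol_garb hγ h'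
  have c1 := sol_cont hγ hW h
  have c2 := sol_cont hγ hW h'
  have G1 : ∀ s ∈ Ico 0 T, _ := fun s hs => G_of_sol h hs
  have G2 : ∀ s ∈ Ico 0 T, _ := fun s hs => G_of_sol h' hs
  obtain ⟨hu, hv, hu', -, -, -, -, -, hG, -, -, -⟩ := h
  obtain ⟨hut, hvt, hut', -, -, -, -, -, hGt, -, -, -⟩ := h'
  have hdv : ∀ n k, HasDerivWithinAt (fun r => dsub v vt r n k) (dsub v' vt' t n k) (Ico 0 T) t :=
    fun n k => (hv t ht n k).fun_sub (hvt t ht n k)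
  have hdu : ∀ n k, HasDerivWithinAt (fun r => dsub u ut r n k) (dsub u' ut' t n k) (Ico 0 T) t :=
    fun n k => (hu t ht n k).fun_sub (hut t ht n k)
  have d1 := inner2_deriv (q := q) (N := N) (x := x) hdv hdv
  have d2 := quad_deriv ha N q ht hdu
    (by
      intro r hr Z hZ
      have := a_sub_left ha Z (u r) (ut r)
      rw [g1 r hr Z hZ, g2 r hr Z hZ] at this
      rw [sub_zero] at this
      exact this)
    (by
      intro Z
      refine ((c1 Z).sub (c2 Z)).congr fun r _ => ?_
      exact a_sub_left ha Z (u r) (ut r))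
  have hc : ContinuousOn (fun s => nsq q N x (dsub gv gvt s)) (Ico 0 T) := by
    have k : ∀ n k, ContinuousOn (fun s => dsub u' ut' s n k) (Ico 0 T) :=
      fun n k => (hu' n k).sub (hut' n k)
    refine (inner2_contOn (q := q) (N := N) (x := x) k k).congr fun s hs => ?_
    exact IsG_unique (IsG_sub (hG s hs) (hGt s hs)) (IsG_sub (G1 s hs) (G2 s hs))
  exact ((d1.const_mul (1/2)).fun_add (d2.const_mul (γ/2))).fun_add ((ftc_Ico hc ht).const_mul (μ/4))

lemma deriv_ident (hp : Partition N x) 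
    (h : Solves q N x (Ico 0 T) γ μ W a u u' v v' τ gv) (ha : SymBilin a)
    (h' : SolvesPert q N x (Ico 0 T) γ μ W a ut ut' vt vt' τt gvt (fun _ _ _ => 0) Rv Rτ)
    {t : ℝ} (ht : t ∈ Ico 0 T) :
    (1/2) * (inner2 q N x (dsub v' vt' t) (dsub v vt t) + inner2 q N x (dsub v vt t) (dsub v' vt' t))
        + (γ/2) * (2 * a (dsub u ut t) (dsub u' ut' t))
        + (μ/4) * nsq q N x (dsub gv gvt t)
      = -(3/4) * μ * nsq q N x (dsub gv gvt t) - inner2 q N x (Rv t) (dsub v vt t)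
        + Bm q N x (dsub v vt t) (Rτ t)
        - (intW' q N x W (u t) (dsub u' ut' t) - intW' q N x W (ut t) (dsub u' ut' t)) := by
  have hN : 1 ≤ N := by have := hp.1; omega
  have G : IsGminus q N x (dsub v vt t) (dsub u' ut' t) := IsG_sub (G_of_sol h ht) (G_of_sol h' ht)
  obtain ⟨-, -, -, -, -, -, -, -, hG, -, h2, h3⟩ := h
  obtain ⟨-, -, -, -, -, -, -, -, hGt, -, k2, k3⟩ := h'
  have G' : IsGminus q N x (dsub v vt t) (dsub gv gvt t) := IsG_sub (hG t ht) (hGt t ht)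
  have e1 := h2 t ht _ _ G'
  have e2 := k2 t ht _ _ G'
  have e3 := h3 t ht (dsub u' ut' t)
  have e4 := k3 t ht (dsub u' ut' t)
  rw [inner2_zero_left] at e1 e3
  rw [duality hN] at e1 e2
  rw [inner2_comm, G] at e3 e4
  rw [inner2_comm q N x (Rτ t), G] at e4
  have s1 : inner2 q N x (dsub v' vt' t) (dsub v vt t)
    = inner2 q N x (v' t) (dsub v vt t) - inner2 q N x (vt' t) (dsub v vt t) :=
    inner2_sub_left q N x _ _ _
  have s2 : a (dsub u ut t) (dsub u' ut' t) = a (u t) (dsub u' ut' t) - a (ut t) (dsub u' ut' t) :=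
    a_sub_left ha _ _ _
  have s3 : nsq q N x (dsub gv gvt t) = inner2 q N x (gv t) (dsub gv gvt t)
      - inner2 q N x (gvt t) (dsub gv gvt t) := inner2_sub_left q N x _ _ _
  rw [inner2_comm q N x (dsub v vt t), s1, s2, s3]
  linear_combination e1 - e2 - e3 + e4

lemma bounds (hp : Partition N x) (hγ : 0 < γ) (hμ : 0 ≤ μ) (hW : ContDiff ℝ 3 W)
    (hWpos : ∀ y, 0 ≤ W y) (ha : SymBilin a) {c : ℝ} (hc : 0 < c)
    (hco : ∀ w, dGsq q N x w ≤ c * a w w)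
    (h : Solves q N x (Ico 0 T) γ μ W a u u' v v' τ gv) {E₀ : ℝ}
    (hE : energy q N x γ W a (u 0) (v 0) ≤ E₀) {t : ℝ} (ht : t ∈ Ico 0 T) :
    dGsq q N x (u t) ≤ c * (2 * |E₀| / γ) := by
  have e := (energy_le hp hγ hμ hW ha h ht).trans hE
  rw [energy_split hW] at e
  have w : 0 ≤ ∑ n ∈ Finset.range N, ∫ y in (x n)..(x (n+1)), W (pev q (u t) n y) :=
    Finset.sum_nonneg fun n hn => intervalIntegral.integral_nonneg
      (hp.2.2.2 n (Finset.mem_range.mp hn)).le fun y _ => hWpos _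
  have hn := nsq_nonneg (q := q) hp (v t)
  unfold nsq at hn
  have := le_abs_self E₀
  refine (hco _).trans (mul_le_mul_of_nonneg_left ?_ hc.le)
  rw [le_div_iff₀ hγ]
  linarith

lemma mean_zero (hp : Partition N x)
    (h : Solves q N x (Ico 0 T) γ μ W a u u' v v' τ gv)
    (h' : SolvesPert q N x (Ico 0 T) γ μ W a ut ut' vt vt' τt gvt (fun _ _ _ => 0) Rv Rτ)
    (h0 : intg q N x (fun n k => u 0 n k - ut 0 n k) = 0) {t : ℝ} (ht : t ∈ Ico 0 T) :
    intg q N x (fun n k => u t n k - ut t n k) = 0 := by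
  have := mean_const (q := q) (u := dsub u ut) (u' := dsub u' ut') (v := dsub v vt) hp
    (fun t ht n k => (h.1 t ht n k).fun_sub (h'.1 t ht n k))
    (fun t ht => IsG_sub (G_of_sol h ht) (G_of_sol h' ht)) ht
  exact this.trans h0

lemma intg_sub (q N : ℕ) (x : ℕ → ℝ) (c d : ℕ → ℕ → ℝ) :
    intg q N x (fun n k => c n k - d n k) = intg q N x c - intg q N x d := by
  simp only [intg_eq, inner2_sub_left]

end fin

theorem main (q : ℕ) (ρ : ℝ) (hρ : 1 ≤ ρ) (c : ℝ) (hc : 0 < c)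
    (γ T : ℝ) (hγ : 0 < γ)
    (W : ℝ → ℝ) (hW : ContDiff ℝ 3 W) (hWpos : ∀ y : ℝ, 0 ≤ W y)
    (M E₀ : ℝ) :
    ∃ C > (0 : ℝ), ∀ (N : ℕ) (x : ℕ → ℝ), DG.Partition N x → DG.MeshRatio N x ρ →
      ∀ μ : ℝ, 0 ≤ μ →
      ∀ a : (ℕ → ℕ → ℝ) → (ℕ → ℕ → ℝ) → ℝ, DG.SymBilin a →
        (∀ w : ℕ → ℕ → ℝ, DG.dGsq q N x w ≤ c * a w w) →
      ∀ u u' v v' τ gv : ℝ → ℕ → ℕ → ℝ,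
        DG.Solves q N x (Set.Ico 0 T) γ μ W a u u' v v' τ gv →
      ∀ ut ut' vt vt' τt gvt Rv Rτ : ℝ → ℕ → ℕ → ℝ,
        DG.SolvesPert q N x (Set.Ico 0 T) γ μ W a ut ut' vt vt' τt gvt
          (fun _ _ _ => 0) Rv Rτ →
      DG.intg q N x (fun n k => u 0 n k - ut 0 n k) = 0 →
      (∀ t ∈ Set.Ico (0 : ℝ) T, ∀ n < N, ∀ y ∈ Set.Icc (x n) (x (n + 1)),
        |DG.pev q (ut t) n y| + |DG.pev' q (ut t) n y| ≤ M) →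
      DG.energy q N x γ W a (u 0) (v 0) ≤ E₀ →
      ((∀ t ∈ Set.Ico (0 : ℝ) T, ∀ D : ℝ,
          HasDerivWithinAt (DG.etaR q N x γ μ a u v gv ut vt gvt) D (Set.Ico 0 T) t →
          D ≤ C * DG.etaR q N x γ μ a u v gv ut vt gvt t
                + C * (DG.nsq q N x (Rv t) + DG.wRτ q N x (Rτ t))) ∧
        (∀ t ∈ Set.Ico (0 : ℝ) T,
          DG.etaR q N x γ μ a u v gv ut vt gvt t ≤
            (DG.etaR q N x γ μ a u v gv ut vt gvt 0
              + C * (∫ s in (0 : ℝ)..t, DG.nsq q N x (Rv s))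
              + C * (∫ s in (0 : ℝ)..t, DG.wRτ q N x (Rτ s))) * Real.exp (C * t))) := by
  obtain ⟨K, hK, hinv⟩ := inv_est q
  have hinv : Inv q K := hinv
  have hρ0 : 0 ≤ ρ := by linarith
  obtain ⟨B, hB⟩ : ∃ B, B = c * (2 * |E₀| / γ) := ⟨_, rfl⟩
  have hB0 : 0 ≤ B := by rw [hB]; positivity
  obtain ⟨R, hR⟩ : ∃ R, R = |M| + √(8*B) := ⟨_, rfl⟩
  obtain ⟨L, hL, hb, hl⟩ := W_const W hW R
  obtain ⟨K2, hK2⟩ : ∃ K2, K2 = K + 2*K^2*(1+ρ) := ⟨_, rfl⟩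
  have hK20 : 0 ≤ K2 := by rw [hK2]; positivity
  obtain ⟨Cb, hCb⟩ : ∃ Cb, Cb = (5+ρ)*L^2*(1+8*B) := ⟨_, rfl⟩
  have hCb0 : 0 ≤ Cb := by rw [hCb]; positivity
  obtain ⟨C, hC⟩ : ∃ C, C = 1 + 2*(1/2+K2+(K2+(1/2)*K)) + Cb*c*(2/γ) := ⟨_, rfl⟩
  have hq1 : 0 ≤ Cb*c*(2/γ) := by positivity
  have hC0 : 0 < C := by rw [hC]; positivity
  refine ⟨C, hC0, ?_⟩
  intro N x hp hm μ hμ a ha hco u u' v v' τ gv h ut ut' vt vt' τt gvt Rv Rτ h' h0 hM hE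
  have key : ∀ t ∈ Ico 0 T,
      ((1/2) * (inner2 q N x (dsub v' vt' t) (dsub v vt t) + inner2 q N x (dsub v vt t) (dsub v' vt' t))
        + (γ/2) * (2 * a (dsub u ut t) (dsub u' ut' t))
        + (μ/4) * nsq q N x (dsub gv gvt t)) ≤ C * DG.etaR q N x γ μ a u v gv ut vt gvt t
                + C * (DG.nsq q N x (Rv t) + DG.wRτ q N x (Rτ t)) := by
    intro t ht
    rw [deriv_ident hp h ha h' ht]
    have hBt := bounds hp hγ hμ hW hWpos ha hc hco h hE ht
    rw [← hB] at hBt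
    have hmean := mean_zero hp h h' h0 ht
    have hut : ∀ n < N, ∀ y ∈ Icc (x n) (x (n+1)), |pev q (ut t) n y| ≤ |M| := by
      intro n hn y hy
      have := hM t ht n hn y hy
      have := abs_nonneg (pev' q (ut t) n y)
      have := le_abs_self M
      linarith
    have hmb := mean_bd hp (ut t) hut
    have hmu : intg q N x (u t) = intg q N x (ut t) := by
      rw [intg_sub] at hmean; linarith
    have hs0 := Real.sqrt_nonneg (8*B)
    have hu : ∀ n < N, ∀ y ∈ Icc (x n) (x (n+1)), pev q (u t) n y ∈ Icc (-R) R := by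
      intro n hn y hy
      have p := poincare (q := q) hp (u t) hn hy
      have := Real.abs_le_sqrt (p.trans (by linarith : _ ≤ 8 * B))
      rw [hmu] at this
      have := abs_le.mp this
      have := abs_le.mp hmb
      rw [hR]
      constructor <;> linarith
    have hut' : ∀ n < N, ∀ y ∈ Icc (x n) (x (n+1)), pev q (ut t) n y ∈ Icc (-R) R := by
      intro n hn y hy
      have := abs_le.mp (hut n hn y hy)
      rw [hR]
      constructor <;> linarith
    have G : IsGminus q N x (dsub v vt t) (dsub u' ut' t) :=
      IsG_sub (G_of_sol h ht) (G_of_sol h' ht)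
    have w1 := Wfinal hK hinv hρ0 hp hm _ _ G hW hL hb hl (u t) (ut t) hu hut' hmean hBt
    have w2 := Bm_young hK hinv hρ0 hp hm (dsub v vt t) (Rτ t)
    have w3 := neg_inner_le (q := q) hp (Rv t) (dsub v vt t)
    have w4 := nsq_nonneg (q := q) hp (dsub gv gvt t)
    have w5 := hco (dsub u ut t)
    have w6 := dGsq_nonneg (q := q) hp (dsub u ut t)
    have w7 : 0 ≤ a (dsub u ut t) (dsub u ut t) := by
      by_contra hneg
      have := mul_neg_of_pos_of_neg hc (not_le.mp hneg)
      linarith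
    have w8 := nsq_nonneg (q := q) hp (dsub v vt t)
    have w9 := nsq_nonneg (q := q) hp (Rv t)
    have w10 := wR_nonneg (q := q) hp (Rτ t)
    have w11 : 0 ≤ ∫ s in (0:ℝ)..t, nsq q N x (dsub gv gvt s) :=
      intervalIntegral.integral_nonneg ht.1 fun s _ => nsq_nonneg hp _
    have w12 := mul_nonneg hμ w11
    have w13 := mul_nonneg hμ w4
    rw [← hK2, ← hCb] at w1
    rw [← hK2] at w2
    change _ ≤ _ + Cb * dGsq q N x (dsub u ut t) at w1
    have w14 := mul_le_mul_of_nonneg_left w5 hCb0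
    have hη : (1/2) * nsq q N x (dsub v vt t) + (γ/2) * a (dsub u ut t) (dsub u ut t)
        ≤ etaR q N x γ μ a u v gv ut vt gvt t := by
      unfold etaR; linarith
    have w15 := mul_le_mul_of_nonneg_left hη hC0.le
    generalize etaR q N x γ μ a u v gv ut vt gvt t = η at *
    generalize nsq q N x (dsub v vt t) = A at *
    generalize a (dsub u ut t) (dsub u ut t) = D at *
    have w16 : (1/2+K2+(K2+(1/2)*K)) * A ≤ C * (1/2 * A) := by
      have : 2*(1/2+K2+(K2+(1/2)*K)) ≤ C := by rw [hC]; linarith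
      have := mul_le_mul_of_nonneg_right this (by positivity : 0 ≤ 1/2*A)
      linarith
    have w17 : Cb * (c * D) ≤ C * (γ/2*D) := by
      have : Cb*c*(2/γ) ≤ C := by
        rw [hC]
        have : 0 ≤ 2*(1/2+K2+(K2+(1/2)*K)) := by positivity
        linarith
      have := mul_le_mul_of_nonneg_right this (by positivity : 0 ≤ γ/2*D)
      have e : Cb*c*(2/γ) * (γ/2*D) = Cb * (c*D) := by field_simp
      linarith
    have hC1 : 1 ≤ C := by
      rw [hC]
      have : 0 ≤ 2*(1/2+K2+(K2+(1/2)*K)) := by positivity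
      linarith
    have w18 := mul_le_mul_of_nonneg_right hC1 (add_nonneg w9 w10)
    linarith
  refine ⟨?_, ?_⟩
  · intro t ht D hD
    have := (uniqueDiffOn_Ico 0 T t ht).eq_deriv _ hD (eta_deriv hγ hW ha h h' ht)
    rw [this]
    exact key t ht
  · intro t ht
    obtain ⟨-, -, -, -, -, -, hRv, hRτ, -, -, -, -⟩ := id h'
    exact gronwall_aux hC0.le (fun r hr => eta_deriv hγ hW ha h h' hr)
      (inner2_contOn hRv hRv) (wR_contOn hRτ) (fun s => nsq_nonneg hp _) (fun s => wR_nonneg hp _)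
      key ht

end DGaux

/-- Estimate of the reduced relative entropy, Corollary
"Estimate of reduced relative entropy": with R_u ≡ 0, coercive a, equal
initial means, a W^{1,∞} bound M on ũ_h and an initial-energy bound E₀, there
is C > 0 (depending only on q, ρ, c, γ, T, W, M, E₀, not on the partition)
with d/dt η_R ≤ C η_R + C ∫ R_v² + 𝔥⁻²R_τ², and by Gronwall
η_R(t) ≤ (η_R(0) + C∫₀ᵗ∫ R_v² + C∫₀ᵗ∫ 𝔥⁻²R_τ²) e^{Ct}. -/
theorem stmt_16 (q : ℕ) (hq : 1 ≤ q) (ρ : ℝ) (hρ : 1 ≤ ρ) (c : ℝ) (hc : 0 < c)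
    (γ T : ℝ) (hγ : 0 < γ) (hT : 0 < T)
    (W : ℝ → ℝ) (hW : ContDiff ℝ 3 W) (hWpos : ∀ y : ℝ, 0 ≤ W y)
    (M E₀ : ℝ) :
    ∃ C > (0 : ℝ), ∀ (N : ℕ) (x : ℕ → ℝ), DG.Partition N x → DG.MeshRatio N x ρ →
      ∀ μ : ℝ, 0 ≤ μ →
      ∀ a : (ℕ → ℕ → ℝ) → (ℕ → ℕ → ℝ) → ℝ, DG.SymBilin a →
        (∀ w : ℕ → ℕ → ℝ, DG.dGsq q N x w ≤ c * a w w) →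
      ∀ u u' v v' τ gv : ℝ → ℕ → ℕ → ℝ,
        DG.Solves q N x (Set.Ico 0 T) γ μ W a u u' v v' τ gv →
      ∀ ut ut' vt vt' τt gvt Rv Rτ : ℝ → ℕ → ℕ → ℝ,
        DG.SolvesPert q N x (Set.Ico 0 T) γ μ W a ut ut' vt vt' τt gvt
          (fun _ _ _ => 0) Rv Rτ →
      DG.intg q N x (fun n k => u 0 n k - ut 0 n k) = 0 →
      (∀ t ∈ Set.Ico (0 : ℝ) T, ∀ n < N, ∀ y ∈ Set.Icc (x n) (x (n + 1)),
        |DG.pev q (ut t) n y| + |DG.pev' q (ut t) n y| ≤ M) →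
      DG.energy q N x γ W a (u 0) (v 0) ≤ E₀ →
      ((∀ t ∈ Set.Ico (0 : ℝ) T, ∀ D : ℝ,
          HasDerivWithinAt (DG.etaR q N x γ μ a u v gv ut vt gvt) D (Set.Ico 0 T) t →
          D ≤ C * DG.etaR q N x γ μ a u v gv ut vt gvt t
                + C * (DG.nsq q N x (Rv t) + DG.wRτ q N x (Rτ t))) ∧
        (∀ t ∈ Set.Ico (0 : ℝ) T,
          DG.etaR q N x γ μ a u v gv ut vt gvt t ≤
            (DG.etaR q N x γ μ a u v gv ut vt gvt 0
              + C * (∫ s in (0 : ℝ)..t, DG.nsq q N x (Rv s))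
              + C * (∫ s in (0 : ℝ)..t, DG.wRτ q N x (Rτ s))) * Real.exp (C * t))) := by
  exact DGaux.main q ρ hρ c hc γ T hγ W hW hWpos M E₀
end
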